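/- arXiv:1704.06758 — 7 statements merged into one kernel-verified Lean document; each statement's English description precedes it below -/
import Mathlib

section
/- For all ζ₁, ζ₂ ∈ ℤ³ one has σ_β(ζ₁) ∘ σ_β(ζ₂) = σ_β(ζ₁·ζ₂), where ζ₁·ζ₂ denotes the Heisenberg multiplication (λ₁,μ₁,t₁)·(λ₂,μ₂,t₂) = (λ₁+λ₂, μ₁+μ₂, t₁+t₂+λ₁μ₂−λ₂μ₁); in other words, σ_β is a representation of the integer Heisenberg group on the space of functions A → ℂ. -/
/-- The integer Heisenberg group multiplication on `ℤ × ℤ × ℤ`. -/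
def heisMul (z₁ z₂ : ℤ × ℤ × ℤ) : ℤ × ℤ × ℤ :=
  (z₁.1 + z₂.1, z₁.2.1 + z₂.2.1, z₁.2.2 + z₂.2.2 + z₁.1 * z₂.2.1 - z₂.1 * z₁.2.1)

/-- The character `e(x) = exp(2πix)` (on a choice of rational representatives of `ℚ/ℤ`). -/
noncomputable def eChar (x : ℚ) : ℂ :=
  Complex.exp (2 * Real.pi * Complex.I * (x : ℂ))

/-- The bilinear form `B(x,y) = q(x+y) − q(x) − q(y)` (valued in representatives of `ℚ/ℤ`). -/
def Bform {A : Type} [AddCommGroup A] (q : A → ℚ) (x y : A) : ℚ :=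
  q (x + y) - q x - q y

/-- The Schrödinger representation twisted at `β`:
`(σ_β(λ,μ,t) f)(γ) = e(μ·B(β, γ+λβ) + (t−λμ)·q(β)) · f(γ+λβ)`. -/
noncomputable def sigmaRep {A : Type} [AddCommGroup A] (q : A → ℚ) (β : A)
    (ζ : ℤ × ℤ × ℤ) (f : A → ℂ) : A → ℂ :=
  fun γ =>
    eChar ((ζ.2.1 : ℚ) * Bform q β (γ + ζ.1 • β) + ((ζ.2.2 : ℚ) - (ζ.1 : ℚ) * (ζ.2.1 : ℚ)) * q β)
      * f (γ + ζ.1 • β)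

lemma eChar_add (x y : ℚ) : eChar (x + y) = eChar x * eChar y := by
  simp only [eChar, ← Complex.exp_add]
  congr 1
  push_cast
  ring

lemma eChar_intCast (k : ℤ) : eChar k = 1 :=
  Complex.exp_eq_one_iff.2 ⟨k, by push_cast; ring⟩

lemma eChar_add_intCast (x : ℚ) (k : ℤ) : eChar (x + k) = eChar x := by
  rw [eChar_add, eChar_intCast, mul_one]

lemma exists_Bform_self_zsmul {A : Type} [AddCommGroup A] (q : A → ℚ)
    (hq : ∀ (n : ℤ) (x : A), ∃ k : ℤ, q (n • x) = (n : ℚ) ^ 2 * q x + k) (x : A) (n : ℤ) :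
    ∃ k : ℤ, Bform q x (n • x) = 2 * n * q x + k := by
  obtain ⟨a, ha⟩ := hq (1 + n) x
  obtain ⟨b, hb⟩ := hq n x
  refine ⟨a - b, ?_⟩
  rw [add_smul, one_smul] at ha
  rw [Bform, ha, hb]
  push_cast
  ring

/-- For a finite quadratic form `q : A → ℚ/ℤ` (given by a rational-valued representative
whose defining properties hold modulo `ℤ`), the operators `σ_β` satisfy
`σ_β(ζ₁) ∘ σ_β(ζ₂) = σ_β(ζ₁·ζ₂)` for the Heisenberg multiplication; i.e. `σ_β` is a
representation of the integer Heisenberg group on functions `A → ℂ`. -/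
theorem sigmaRep_mul {A : Type} [AddCommGroup A] [Fintype A] (q : A → ℚ) (β : A)
    (hq : ∀ (n : ℤ) (x : A), ∃ k : ℤ, q (n • x) = (n : ℚ) ^ 2 * q x + k)
    (hB₁ : ∀ x x' y : A, ∃ k : ℤ, Bform q (x + x') y = Bform q x y + Bform q x' y + k)
    (hB₂ : ∀ x y y' : A, ∃ k : ℤ, Bform q x (y + y') = Bform q x y + Bform q x y' + k) :
    ∀ (ζ₁ ζ₂ : ℤ × ℤ × ℤ) (f : A → ℂ),
      sigmaRep q β ζ₁ (sigmaRep q β ζ₂ f) = sigmaRep q β (heisMul ζ₁ ζ₂) f := by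
  rintro ⟨l₁, m₁, t₁⟩ ⟨l₂, m₂, t₂⟩ f
  funext γ
  obtain ⟨a, ha⟩ := exists_Bform_self_zsmul q hq β l₂
  obtain ⟨b, hb⟩ := hB₂ β (γ + l₁ • β) (l₂ • β)
  simp only [sigmaRep, heisMul, add_smul, ← add_assoc]
  rw [← mul_assoc, ← eChar_add, ← eChar_add_intCast _ (m₁ * (a + b)), hb, ha]
  congr 2
  push_cast
  ring
end

section
/- For every complex s with Re(s) > 2, the series Σ_{c=1}^∞ K_c c^{−s−e−1} and Σ_{c=1}^∞ N(c) c^{−s−e} converge absolutely and ζ(s) · (Σ_{c=1}^∞ K_c c^{−s−e−1}) = Σ_{c=1}^∞ N(c) c^{−s−e}, where ζ is the Riemann zeta function. -/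
open Matrix

/-- The quadratic form `q(x) = ½ xᵀSx` on `ℚ^e`. -/
noncomputable def qform {e : ℕ} (S : Matrix (Fin e) (Fin e) ℤ) (x : Fin e → ℚ) : ℚ :=
  (1 / 2) * (x ⬝ᵥ (S.map (Int.cast : ℤ → ℚ)).mulVec x)

/-- The bilinear form `⟨x,y⟩ = xᵀSy` on `ℚ^e`. -/
noncomputable def bform {e : ℕ} (S : Matrix (Fin e) (Fin e) ℤ) (x y : Fin e → ℚ) : ℚ :=
  x ⬝ᵥ (S.map (Int.cast : ℤ → ℚ)).mulVec y

/-- The quadratic polynomial `f(v,λ) = q(v + λβ − γ) + mλ² − rλ + n`. -/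
noncomputable def fpoly {e : ℕ} (S : Matrix (Fin e) (Fin e) ℤ) (β γ : Fin e → ℚ)
    (m n r : ℚ) (v : Fin e → ℤ) (l : ℤ) : ℚ :=
  qform S ((fun i => (v i : ℚ)) + (l : ℚ) • β - γ) + m * (l : ℚ) ^ 2 - r * (l : ℚ) + n

/-- The representation number `N(a)`: the number of `(v,λ) ∈ (ℤ/aℤ)^e × (ℤ/aℤ)` with
`f(v,λ) ≡ 0 (mod a)` (computed with the representatives `0,…,a−1`). -/
noncomputable def Ncount {e : ℕ} (S : Matrix (Fin e) (Fin e) ℤ) (β γ : Fin e → ℚ)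
    (m n r : ℚ) (a : ℕ) : ℕ :=
  Nat.card {p : (Fin e → Fin a) × Fin a //
    ∃ k : ℤ, fpoly S β γ m n r (fun i => ((p.1 i : ℕ) : ℤ)) ((p.2 : ℕ) : ℤ) = (a : ℚ) * k}

/-- The Kloosterman sum
`K_c = Σ_{d ∈ (ℤ/cℤ)ˣ} Σ_{(v,λ) ∈ (ℤ/cℤ)^e × (ℤ/cℤ)} exp(2πi·d·f(v,λ)/c)`. -/
noncomputable def Kclo {e : ℕ} (S : Matrix (Fin e) (Fin e) ℤ) (β γ : Fin e → ℚ)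
    (m n r : ℚ) (c : ℕ) : ℂ :=
  ∑ d ∈ (Finset.range c).filter (fun d => Nat.Coprime d c),
    ∑ p : (Fin e → Fin c) × Fin c,
      Complex.exp (2 * Real.pi * Complex.I *
        ((((d : ℚ) * fpoly S β γ m n r (fun i => ((p.1 i : ℕ) : ℤ)) ((p.2 : ℕ) : ℤ)) / (c : ℚ) : ℚ) : ℂ))

open Finset

/-- The residues `0, …, c - 1` as an enumeration of `ZMod c`. -/
noncomputable def finEquivZMod (c : ℕ) [NeZero c] : Fin c ≃ ZMod c :=
  Equiv.ofBijective (fun i => ((i : ℕ) : ZMod c)) <| by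
    rw [Fintype.bijective_iff_injective_and_card]
    refine ⟨fun i j h => ?_, by simp [ZMod.card]⟩
    have h' := (ZMod.natCast_eq_natCast_iff' _ _ _).1 h
    rw [Nat.mod_eq_of_lt i.2, Nat.mod_eq_of_lt j.2] at h'
    exact Fin.ext h'

@[simp]
theorem finEquivZMod_apply (c : ℕ) [NeZero c] (i : Fin c) :
    finEquivZMod c i = ((i : ℕ) : ZMod c) := rfl

/-- Residues of pairs `(v, λ)`, as an enumeration of `(ℤ/cℤ)^e × ℤ/cℤ`. -/
noncomputable def finPairEquivZMod (e c : ℕ) [NeZero c] :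
    (Fin e → Fin c) × Fin c ≃ (Fin e → ZMod c) × ZMod c :=
  ((Equiv.refl _).arrowCongr (finEquivZMod c)).prodCongr (finEquivZMod c)

/-- The inhomogeneous quadratic polynomial in `(v, λ)` with the given integer coefficients,
evaluated in a commutative ring. -/
def quadPoly {e : ℕ} (A : Matrix (Fin e) (Fin e) ℤ) (b c : Fin e → ℤ) (M R N : ℤ)
    {T : Type*} [CommRing T] (x : (Fin e → T) × T) : T :=
  ∑ i, ∑ j, (A i j : T) * x.1 i * x.1 j + x.2 * ∑ i, (b i : T) * x.1 i
    - ∑ i, (c i : T) * x.1 i + (M : T) * x.2 ^ 2 - (R : T) * x.2 + (N : T)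

theorem map_quadPoly {e : ℕ} (A : Matrix (Fin e) (Fin e) ℤ) (b c : Fin e → ℤ) (M R N : ℤ)
    {T U : Type*} [CommRing T] [CommRing U] (φ : T →+* U) (x : (Fin e → T) × T) :
    φ (quadPoly A b c M R N x) = quadPoly A b c M R N (fun i => φ (x.1 i), φ x.2) := by
  simp [quadPoly]

theorem exists_quadForm_half {e : ℕ} {S : Matrix (Fin e) (Fin e) ℤ} (hsym : S.IsSymm)
    (hdiag : ∀ i, Even (S i i)) :
    ∃ A : Matrix (Fin e) (Fin e) ℤ, S = A + Aᵀ := by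
  refine ⟨.of fun i j => if i < j then S i j else if i = j then S i i / 2 else 0, ?_⟩
  ext i j
  rw [Matrix.add_apply, Matrix.transpose_apply, Matrix.of_apply, Matrix.of_apply]
  rcases lt_trichotomy i j with h | rfl | h
  · simp [h, h.not_gt, h.ne']
  · simp only [lt_irrefl, if_false, if_true]
    have := hdiag i
    rw [Int.even_iff] at this
    omega
  · simp [h, h.not_gt, h.ne', hsym.apply i j]

theorem exists_fpoly_eq_quadPoly {e : ℕ} {S : Matrix (Fin e) (Fin e) ℤ} (hsym : S.IsSymm)
    (hdiag : ∀ i, Even (S i i)) {β γ : Fin e → ℚ}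
    (hβ : ∀ i, ∃ k : ℤ, (S.map (Int.cast : ℤ → ℚ)).mulVec β i = (k : ℚ))
    (hγ : ∀ i, ∃ k : ℤ, (S.map (Int.cast : ℤ → ℚ)).mulVec γ i = (k : ℚ))
    {m n r : ℚ}
    (hm : ∃ k : ℤ, m + qform S β = (k : ℚ))
    (hn : ∃ k : ℤ, n + qform S γ = (k : ℚ))
    (hr : ∃ k : ℤ, r + bform S γ β = (k : ℚ)) :
    ∃ (A : Matrix (Fin e) (Fin e) ℤ) (b c : Fin e → ℤ) (M R N : ℤ),
      ∀ (v : Fin e → ℤ) (l : ℤ),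
        fpoly S β γ m n r v l = (quadPoly A b c M R N (v, l) : ℤ) := by
  obtain ⟨A, hA⟩ := exists_quadForm_half hsym hdiag
  choose b hb using hβ
  choose c hc using hγ
  obtain ⟨M, hM⟩ := hm
  obtain ⟨N, hN⟩ := hn
  obtain ⟨R, hR⟩ := hr
  refine ⟨A, b, c, M, R, N, fun v l => ?_⟩
  set Q := S.map (Int.cast : ℤ → ℚ) with hQ
  set w : Fin e → ℚ := fun i => (v i : ℚ) with hw
  have hcomm (x y : Fin e → ℚ) : x ⬝ᵥ Q.mulVec y = y ⬝ᵥ Q.mulVec x := by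
    have hQt : Qᵀ = Q := by rw [hQ, ← Matrix.transpose_map, hsym.eq]
    rw [Matrix.dotProduct_mulVec, ← Matrix.mulVec_transpose, hQt, dotProduct_comm]
  have hww : w ⬝ᵥ Q.mulVec w = 2 * ∑ i, ∑ j, (A i j : ℚ) * v i * v j := by
    have h1 : w ⬝ᵥ Q.mulVec w
        = ∑ i, ∑ j, (A i j : ℚ) * v i * v j + ∑ i, ∑ j, (A j i : ℚ) * v i * v j := by
      simp only [dotProduct, Matrix.mulVec, hQ, hA, hw, Matrix.map_apply, Matrix.add_apply,
        Matrix.transpose_apply, Finset.mul_sum, ← Finset.sum_add_distrib]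
      refine sum_congr rfl fun i _ => sum_congr rfl fun j _ => ?_
      push_cast
      ring
    have h2 : ∑ i, ∑ j, (A j i : ℚ) * v i * v j = ∑ i, ∑ j, (A i j : ℚ) * v i * v j := by
      rw [sum_comm]
      exact sum_congr rfl fun i _ => sum_congr rfl fun j _ => by ring
    rw [h1, h2]
    ring
  have hwβ : w ⬝ᵥ Q.mulVec β = ∑ i, (b i : ℚ) * v i :=
    sum_congr rfl fun i _ => by rw [hb i, mul_comm]
  have hwγ : w ⬝ᵥ Q.mulVec γ = ∑ i, (c i : ℚ) * v i :=
    sum_congr rfl fun i _ => by rw [hc i, mul_comm]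
  simp only [qform, bform, ← hQ] at hM hN hR
  simp only [fpoly, qform, quadPoly, ← hQ, ← hw, Matrix.mulVec_sub, Matrix.mulVec_add,
    Matrix.mulVec_smul, dotProduct_sub, sub_dotProduct, dotProduct_add, add_dotProduct,
    dotProduct_smul, smul_dotProduct, smul_eq_mul, Int.cast_id]
  rw [hcomm β w, hcomm γ w, hcomm β γ, hww, hwβ, hwγ]
  push_cast
  rw [← hM, ← hN, ← hR]
  ring

theorem sum_range_eq_sum_divisors {a : ℕ} (ha : a ≠ 0) (g : ℕ → ℂ) :
    ∑ d ∈ range a, g d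
      = ∑ c ∈ a.divisors, ∑ d ∈ (range c).filter (fun d => Nat.Coprime d c), g (a / c * d) := by
  rw [← sum_fiberwise_of_maps_to (s := range a) (t := a.divisors) (g := fun d => a / Nat.gcd d a)
    (fun d _ => Nat.mem_divisors.2 ⟨Nat.div_dvd_of_dvd (Nat.gcd_dvd_right d a), ha⟩)]
  refine sum_congr rfl fun c hc => ?_
  obtain ⟨k, rfl⟩ := (Nat.mem_divisors.1 hc).1
  have hc0 : 0 < c := Nat.pos_of_mul_pos_right (Nat.pos_of_ne_zero ha)
  have hk0 : 0 < k := Nat.pos_of_mul_pos_left (Nat.pos_of_ne_zero ha)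
  rw [Nat.mul_div_cancel_left k hc0]
  symm
  refine sum_nbij (fun d => k * d) ?_ ?_ ?_ fun _ _ => rfl
  · intro d hd
    simp only [mem_filter, mem_range] at hd ⊢
    refine ⟨by rw [mul_comm c k]; gcongr; exact hd.1, ?_⟩
    rw [mul_comm c k, Nat.gcd_mul_left, hd.2, mul_one, Nat.mul_div_cancel_left c hk0]
  · intro x _ y _ h
    exact Nat.eq_of_mul_eq_mul_left hk0 h
  · intro d hd
    simp only [coe_filter, mem_range, Set.mem_ofPred_eq, Set.mem_image] at hd ⊢
    have hg : Nat.gcd d (c * k) = k := by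
      have h := Nat.div_mul_cancel (Nat.gcd_dvd_right d (c * k))
      rw [hd.2] at h
      exact Nat.eq_of_mul_eq_mul_left hc0 h
    obtain ⟨t, rfl⟩ : k ∣ d := hg ▸ Nat.gcd_dvd_left d (c * k)
    refine ⟨t, ⟨?_, ?_⟩, rfl⟩
    · exact Nat.lt_of_mul_lt_mul_left (mul_comm c k ▸ hd.1)
    · rw [mul_comm c k, Nat.gcd_mul_left] at hg
      exact Nat.eq_of_mul_eq_mul_left hk0 (by rw [hg, mul_one])

theorem stdAddChar_mul_castHom {a c : ℕ} [NeZero a] [NeZero c] (h : c ∣ a) (d : ℕ) (z : ZMod a) :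
    ZMod.stdAddChar (((a / c * d : ℕ) : ZMod a) * z)
      = ZMod.stdAddChar ((d : ZMod c) * ZMod.castHom h (ZMod c) z) := by
  obtain ⟨k, rfl⟩ := ZMod.intCast_surjective z
  obtain ⟨t, rfl⟩ := h
  have hc : (c : ℂ) ≠ 0 := NeZero.ne _
  have ht : (t : ℂ) ≠ 0 := by
    have := NeZero.ne (c * t)
    exact_mod_cast right_ne_zero_of_mul this
  rw [Nat.mul_div_cancel_left t (NeZero.pos c), map_intCast]
  have h1 := ZMod.stdAddChar_coe (N := c * t) ((t * d : ℕ) * k)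
  have h2 := ZMod.stdAddChar_coe (N := c) (d * k)
  push_cast at h1 h2 ⊢
  rw [h1, h2]
  congr 1
  field_simp

theorem sum_comp_castHom {e a c : ℕ} [NeZero a] [NeZero c] (h : c ∣ a)
    (g : (Fin e → ZMod c) × ZMod c → ℂ) :
    ∑ x : (Fin e → ZMod a) × ZMod a,
        g (fun i => ZMod.castHom h (ZMod c) (x.1 i), ZMod.castHom h (ZMod c) x.2)
      = ((a / c : ℕ) : ℂ) ^ (e + 1) * ∑ y, g y := by
  classical
  let φ : (Fin e → ZMod a) × ZMod a →+ (Fin e → ZMod c) × ZMod c :=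
    { toFun := fun x => (fun i => ZMod.castHom h (ZMod c) (x.1 i), ZMod.castHom h (ZMod c) x.2)
      map_zero' := by ext <;> simp
      map_add' := fun x y => by ext <;> simp [-ZMod.castHom_apply] }
  have hsurj : Function.Surjective φ := fun y => by
    choose f hf using ZMod.castHom_surjective h
    exact ⟨(fun i => f (y.1 i), f y.2), by ext <;> simp [φ, -ZMod.castHom_apply, hf]⟩
  have hfib (y) : #{x | φ x = y} = #{x | φ x = 0} :=
    AddMonoidHom.card_fiber_eq_of_mem_range φ (hsurj y) (hsurj 0)
  have hcard : a ^ (e + 1) = c ^ (e + 1) * #{x | φ x = 0} := by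
    have h1 := card_eq_sum_card_fiberwise (f := φ) (s := univ) (t := univ) (by simp)
    simp_rw [hfib] at h1
    simpa [ZMod.card, pow_succ] using h1
  have hker : #{x | φ x = 0} = (a / c) ^ (e + 1) := by
    obtain ⟨t, rfl⟩ := h
    rw [Nat.mul_div_cancel_left t (NeZero.pos c)]
    rw [mul_pow] at hcard
    exact (Nat.eq_of_mul_eq_mul_left (pow_pos (NeZero.pos c) _) hcard).symm
  calc _ = ∑ x, g (φ x) := rfl
    _ = ∑ y, ∑ x with φ x = y, g (φ x) := (sum_fiberwise_of_maps_to (by simp) _).symm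
    _ = ∑ y, ((a / c : ℕ) : ℂ) ^ (e + 1) * g y := by
      refine sum_congr rfl fun y _ => ?_
      rw [sum_congr rfl (g := fun _ => g y) fun x hx => by rw [(mem_filter.1 hx).2], sum_const,
        hfib, hker, nsmul_eq_mul]
      push_cast
      rfl
    _ = _ := (mul_sum _ _ _).symm

section Arithmetic

variable {e : ℕ} {S : Matrix (Fin e) (Fin e) ℤ} {β γ : Fin e → ℚ} {m n r : ℚ}
  {A : Matrix (Fin e) (Fin e) ℤ} {b c : Fin e → ℤ} {M R N : ℤ}

theorem intCast_quadPoly_finPair (a : ℕ) [NeZero a] (p : (Fin e → Fin a) × Fin a) :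
    ((quadPoly A b c M R N (fun i => ((p.1 i : ℕ) : ℤ), ((p.2 : ℕ) : ℤ)) : ℤ) : ZMod a)
      = quadPoly A b c M R N (finPairEquivZMod e a p) := by
  refine (map_quadPoly A b c M R N (Int.castRingHom (ZMod a)) _).trans ?_
  congr 1
  ext <;> simp [finPairEquivZMod]

theorem Ncount_eq_card
    (hf : ∀ v l, fpoly S β γ m n r v l = (quadPoly A b c M R N (v, l) : ℤ))
    (a : ℕ) [NeZero a] :
    Ncount S β γ m n r a = #{x : (Fin e → ZMod a) × ZMod a | quadPoly A b c M R N x = 0} := by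
  rw [← Fintype.card_subtype, ← Nat.card_eq_fintype_card, Ncount]
  refine Nat.card_congr ((finPairEquivZMod e a).subtypeEquiv fun p => ?_)
  rw [← intCast_quadPoly_finPair, ZMod.intCast_zmod_eq_zero_iff_dvd, hf]
  exact exists_congr fun k => by exact_mod_cast Iff.rfl

theorem Kclo_eq_sum_stdAddChar
    (hf : ∀ v l, fpoly S β γ m n r v l = (quadPoly A b c M R N (v, l) : ℤ))
    (a : ℕ) [NeZero a] :
    Kclo S β γ m n r a = ∑ d ∈ (range a).filter (fun d => Nat.Coprime d a),
      ∑ x : (Fin e → ZMod a) × ZMod a,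
        ZMod.stdAddChar ((d : ZMod a) * quadPoly A b c M R N x) := by
  refine sum_congr rfl fun d _ => Fintype.sum_equiv (finPairEquivZMod e a) _ _ fun p => ?_
  rw [← intCast_quadPoly_finPair, hf]
  have h := ZMod.stdAddChar_coe (N := a)
    (d * quadPoly A b c M R N (fun i => ((p.1 i : ℕ) : ℤ), ((p.2 : ℕ) : ℤ)))
  push_cast at h ⊢
  rw [h]
  congr 1
  ring

theorem mul_Ncount_eq_sum_divisors
    (hf : ∀ v l, fpoly S β γ m n r v l = (quadPoly A b c M R N (v, l) : ℤ))
    {a : ℕ} (ha : a ≠ 0) :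
    (a : ℂ) * Ncount S β γ m n r a
      = ∑ d ∈ a.divisors, ((a / d : ℕ) : ℂ) ^ (e + 1) * Kclo S β γ m n r d := by
  have : NeZero a := ⟨ha⟩
  have horth (z : ZMod a) :
      ∑ d ∈ range a, ZMod.stdAddChar ((d : ZMod a) * z) = if z = 0 then (a : ℂ) else 0 := by
    rw [sum_range, Fintype.sum_equiv (finEquivZMod a)
      (fun i : Fin a => ZMod.stdAddChar (((i : ℕ) : ZMod a) * z))
      (fun t => ZMod.stdAddChar (t * z)) fun _ => rfl,
      AddChar.sum_mulShift z (ZMod.isPrimitive_stdAddChar a), ZMod.card]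
    split_ifs <;> simp
  calc (a : ℂ) * Ncount S β γ m n r a
      = ∑ x : (Fin e → ZMod a) × ZMod a,
          ∑ d ∈ range a, ZMod.stdAddChar ((d : ZMod a) * quadPoly A b c M R N x) := by
        simp_rw [horth]
        rw [← sum_filter, sum_const, Ncount_eq_card hf, nsmul_eq_mul, mul_comm]
    _ = ∑ d ∈ range a, ∑ x : (Fin e → ZMod a) × ZMod a,
          ZMod.stdAddChar ((d : ZMod a) * quadPoly A b c M R N x) := sum_comm
    _ = _ := by
        rw [sum_range_eq_sum_divisors ha]
        refine sum_congr rfl fun k hk => ?_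
        have hka := (Nat.mem_divisors.1 hk).1
        have : NeZero k := ⟨ne_zero_of_dvd_ne_zero ha hka⟩
        rw [Kclo_eq_sum_stdAddChar hf, mul_sum]
        refine sum_congr rfl fun d _ => ?_
        rw [← sum_comp_castHom hka]
        refine sum_congr rfl fun x _ => ?_
        rw [stdAddChar_mul_castHom hka, map_quadPoly]

theorem norm_Kclo_le (a : ℕ) : ‖Kclo S β γ m n r a‖ ≤ (a : ℝ) ^ (e + 2) := by
  have hexp (q : ℚ) : ‖Complex.exp (2 * Real.pi * Complex.I * (q : ℂ))‖ = 1 := by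
    rw [show 2 * Real.pi * Complex.I * (q : ℂ) = ((2 * Real.pi * q : ℝ) : ℂ) * Complex.I by
      push_cast; ring]
    exact Complex.norm_exp_ofReal_mul_I _
  have hinner (d : ℕ) : ‖∑ p : (Fin e → Fin a) × Fin a,
      Complex.exp (2 * Real.pi * Complex.I * ((((d : ℚ) *
        fpoly S β γ m n r (fun i => ((p.1 i : ℕ) : ℤ)) ((p.2 : ℕ) : ℤ)) / (a : ℚ) : ℚ) : ℂ))‖
      ≤ (a : ℝ) ^ (e + 1) := by
    refine (norm_sum_le _ _).trans ?_
    simp_rw [hexp]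
    simp [pow_succ]
  refine (norm_sum_le_of_le _ fun d _ => hinner d).trans ?_
  rw [sum_const, nsmul_eq_mul, pow_succ' (a : ℝ) (e + 1)]
  gcongr
  exact (card_filter_le _ _).trans (card_range a).le

theorem Ncount_le (a : ℕ) : Ncount S β γ m n r a ≤ a ^ (e + 1) := by
  refine (Finite.card_subtype_le _).trans ?_
  simp [pow_succ]

theorem Ncount_div_pow_eq_sum_divisorsAntidiagonal
    (hf : ∀ v l, fpoly S β γ m n r v l = (quadPoly A b c M R N (v, l) : ℤ))
    {a : ℕ} (ha : a ≠ 0) :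
    (Ncount S β γ m n r a : ℂ) / (a : ℂ) ^ e
      = ∑ p ∈ a.divisorsAntidiagonal, Kclo S β γ m n r p.2 / (p.2 : ℂ) ^ (e + 1) := by
  have ha' : (a : ℂ) ≠ 0 := Nat.cast_ne_zero.2 ha
  rw [Nat.sum_divisorsAntidiagonal' (f := fun _ y => Kclo S β γ m n r y / (y : ℂ) ^ (e + 1)),
    div_eq_iff (pow_ne_zero _ ha'), ← mul_right_inj' ha', mul_Ncount_eq_sum_divisors hf ha,
    sum_mul, mul_sum]
  refine sum_congr rfl fun k hk => ?_
  have hka := (Nat.mem_divisors.1 hk).1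
  have hk' : (k : ℂ) ≠ 0 := Nat.cast_ne_zero.2 (ne_zero_of_dvd_ne_zero ha hka)
  rw [Nat.cast_div hka hk', div_pow, pow_succ' (a : ℂ)]
  field_simp

end Arithmetic

/-- For `Re(s) > 2`, the series `Σ_{c=1}^∞ K_c c^{−s−e−1}` and `Σ_{c=1}^∞ N(c) c^{−s−e}`
converge absolutely and `ζ(s) · Σ_c K_c c^{−s−e−1} = Σ_c N(c) c^{−s−e}`. -/
theorem zeta_times_kloosterman_series (e : ℕ) (he : 1 ≤ e)
    (S : Matrix (Fin e) (Fin e) ℤ) (hsym : S.IsSymm) (hdiag : ∀ i, Even (S i i))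
    (hdet : S.det ≠ 0) (β γ : Fin e → ℚ)
    (hβ : ∀ i, ∃ k : ℤ, (S.map (Int.cast : ℤ → ℚ)).mulVec β i = (k : ℚ))
    (hγ : ∀ i, ∃ k : ℤ, (S.map (Int.cast : ℤ → ℚ)).mulVec γ i = (k : ℚ))
    (m n r : ℚ)
    (hm : ∃ k : ℤ, m + qform S β = (k : ℚ))
    (hn : ∃ k : ℤ, n + qform S γ = (k : ℚ))
    (hr : ∃ k : ℤ, r + bform S γ β = (k : ℚ))
    (s : ℂ) (hs : 2 < s.re) :
    Summable (fun c : ℕ =>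
      ‖if c = 0 then (0 : ℂ) else Kclo S β γ m n r c * (c : ℂ) ^ (-s - e - 1)‖) ∧
    Summable (fun c : ℕ =>
      ‖if c = 0 then (0 : ℂ) else (Ncount S β γ m n r c : ℂ) * (c : ℂ) ^ (-s - e)‖) ∧
    riemannZeta s *
        (∑' c : ℕ, if c = 0 then (0 : ℂ) else Kclo S β γ m n r c * (c : ℂ) ^ (-s - e - 1)) =
      ∑' c : ℕ, if c = 0 then (0 : ℂ) else (Ncount S β γ m n r c : ℂ) * (c : ℂ) ^ (-s - e) := by
  obtain ⟨A, b, c, M, R, N, hf⟩ := exists_fpoly_eq_quadPoly hsym hdiag hβ hγ hm hn hr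
  set K : ℕ → ℂ := fun c => Kclo S β γ m n r c / (c : ℂ) ^ (e + 1) with hK
  set L : ℕ → ℂ := fun c => (Ncount S β γ m n r c : ℂ) / (c : ℂ) ^ e with hL
  have hKterm : (fun c : ℕ => if c = 0 then (0 : ℂ)
      else Kclo S β γ m n r c * (c : ℂ) ^ (-s - e - 1)) = LSeries.term K s := by
    ext c
    rw [LSeries.term_def]
    split_ifs with hc
    · rfl
    · have hc' : (c : ℂ) ≠ 0 := Nat.cast_ne_zero.2 hc
      rw [show -s - e - 1 = -(((e + 1 : ℕ) : ℂ) + s) by push_cast; ring, Complex.cpow_neg,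
        Complex.cpow_add _ _ hc', Complex.cpow_natCast, hK, ← div_eq_mul_inv, div_div]
  have hLterm : (fun c : ℕ => if c = 0 then (0 : ℂ)
      else (Ncount S β γ m n r c : ℂ) * (c : ℂ) ^ (-s - e)) = LSeries.term L s := by
    ext c
    rw [LSeries.term_def]
    split_ifs with hc
    · rfl
    · have hc' : (c : ℂ) ≠ 0 := Nat.cast_ne_zero.2 hc
      rw [show -s - e = -((e : ℂ) + s) by ring, Complex.cpow_neg,
        Complex.cpow_add _ _ hc', Complex.cpow_natCast, hL, ← div_eq_mul_inv, div_div]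
  have hKsum : LSeriesSummable K s := by
    refine LSeriesSummable_of_le_const_mul_rpow hs ⟨1, fun c hc => ?_⟩
    have hc' : (0 : ℝ) < c := by positivity
    rw [hK, norm_div, norm_pow, Complex.norm_natCast, div_le_iff₀ (by positivity),
      show (2 : ℝ) - 1 = 1 by norm_num, Real.rpow_one, one_mul, ← pow_succ']
    exact norm_Kclo_le c
  have hLsum : LSeriesSummable L s := by
    refine LSeriesSummable_of_le_const_mul_rpow hs ⟨1, fun c hc => ?_⟩
    have hc' : (0 : ℝ) < c := by positivity
    rw [hL, norm_div, norm_pow, Complex.norm_natCast, Complex.norm_natCast,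
      div_le_iff₀ (by positivity), show (2 : ℝ) - 1 = 1 by norm_num, Real.rpow_one, one_mul,
      ← pow_succ']
    exact_mod_cast Ncount_le c
  have hs1 : 1 < s.re := by linarith
  have hconv : LSeries (LSeries.convolution 1 K) s = LSeries L s := by
    refine LSeries_congr (fun {a} ha => ?_) s
    simp only [LSeries.convolution_def, hL]
    rw [Ncount_div_pow_eq_sum_divisorsAntidiagonal hf ha]
    simp [hK]
  refine ⟨Summable.norm (hKterm ▸ hKsum), Summable.norm (hLterm ▸ hLsum), ?_⟩
  rw [hKterm, hLterm, ← LSeries_one_eq_riemannZeta hs1]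
  exact (LSeries_convolution' (LSeriesSummable_one_iff.2 hs1) hKsum).symm.trans hconv
end

section
/- Let p be an odd prime, let e ≥ 2 be an even integer, let S be a symmetric e×e integer matrix with even diagonal entries, and let m', t be integers such that p ∤ det S, p ∤ m', and p ∤ t. Then for every integer ν ≥ 1, #{(v,λ) ∈ (ℤ/p^νℤ)^e × (ℤ/p^νℤ) : vᵀSv + 2m'λ² + 2t ≡ 0 (mod p^ν)} = p^{νe} + ε·p^{νe − e/2}, where ε is the Legendre symbol of (−1)^{e/2+1}·m'·t·det S modulo p. -/
open Matrix

theorem exists_diagonalization {F : Type*} [Field F] (hF : ringChar F ≠ 2) {n : ℕ}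
    (S : Matrix (Fin n) (Fin n) F) (hS : S.IsSymm) :
    ∃ (P : Matrix (Fin n) (Fin n) F) (w : Fin n → F),
      IsUnit P.det ∧ Pᵀ * S * P = diagonal w := by
  have : Invertible (2 : F) := invertibleOfNonzero (Ring.two_ne_zero hF)
  have hsymm : (Matrix.toBilin' S).IsSymm := by
    rwa [Matrix.isSymm_toBilin'_iff_isSymm]
  obtain ⟨v', hv'⟩ := LinearMap.BilinForm.exists_orthogonal_basis
    (LinearMap.BilinForm.isSymm_iff.1 hsymm)
  let f := finCongr (Module.finrank_fin_fun F (n := n))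
  let v := v'.reindex f
  refine ⟨(Pi.basisFun F (Fin n)).toMatrix v, fun i => Matrix.toBilin' S (v i) (v i), ?_, ?_⟩
  · have h := Module.Basis.toMatrix_mul_toMatrix_flip (Pi.basisFun F (Fin n)) v
    have := congrArg Matrix.det h
    rw [Matrix.det_mul, Matrix.det_one] at this
    exact IsUnit.of_mul_eq_one _ this
  · have h := LinearMap.BilinForm.toMatrix_mul_basis_toMatrix (Pi.basisFun F (Fin n)) v
      (Matrix.toBilin' S)
    rw [LinearMap.BilinForm.toMatrix_basisFun, LinearMap.BilinForm.toMatrix'_toBilin'] at h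
    rw [h]
    ext i j
    rw [LinearMap.BilinForm.toMatrix_apply]
    by_cases hij : i = j
    · simp [hij]
    · rw [Matrix.diagonal_apply_ne _ hij]
      simpa [v] using hv' (show f.symm i ≠ f.symm j by simpa using hij)

section FiniteField

variable {F : Type*} [Field F] [Fintype F] [DecidableEq F]

theorem sum_ite_sq_eq (hF : ringChar F ≠ 2) (a : F) :
    ∑ c : F, (if c ^ 2 = a then (1 : ℤ) else 0) = 1 + quadraticChar F a := by
  rw [Finset.sum_boole, add_comm, ← quadraticChar_card_sqrts hF a]
  congr 2
  ext c
  simp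

theorem sum_comp_sq (hF : ringChar F ≠ 2) (g : F → ℤ) :
    ∑ c : F, g (c ^ 2) = ∑ y : F, g y * (1 + quadraticChar F y) := by
  simp_rw [← sum_ite_sq_eq hF, Finset.mul_sum]
  rw [Finset.sum_comm]
  simp

theorem sum_ite_mul_sq_eq (hF : ringChar F ≠ 2) {w : F} (hw : w ≠ 0) (b : F) :
    ∑ c : F, (if b = w * c ^ 2 then (1 : ℤ) else 0) = 1 + quadraticChar F (w * b) := by
  have h : quadraticChar F (w * b) = quadraticChar F (b / w) := by
    rw [show w * b = w ^ 2 * (b / w) by field_simp, map_mul, quadraticChar_sq_one' hw, one_mul]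
  rw [h, ← sum_ite_sq_eq hF]
  refine Finset.sum_congr rfl fun c _ => if_congr ?_ rfl rfl
  rw [eq_div_iff hw, mul_comm, eq_comm]

theorem sum_quadraticChar_sub_mul_sq (hF : ringChar F ≠ 2) {w : F} (hw : w ≠ 0) (b : F) :
    ∑ c : F, quadraticChar F (b - w * c ^ 2) =
      quadraticChar F (-w) * (Fintype.card F * (if b = 0 then 1 else 0) - 1) := by
  rw [sum_comp_sq hF fun y => quadraticChar F (b - w * y)]
  simp_rw [mul_add, mul_one, Finset.sum_add_distrib]
  have h1 : ∑ y : F, quadraticChar F (b - w * y) = 0 := by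
    rw [← quadraticChar_sum_zero hF]
    exact Equiv.sum_comp ((Equiv.mulLeft₀ w hw).trans (Equiv.subLeft b)) fun y => quadraticChar F y
  rw [h1, zero_add]
  by_cases hb : b = 0
  · have h2 (y : F) : quadraticChar F (b - w * y) * quadraticChar F y =
        quadraticChar F (-w) * (1 - if y = 0 then 1 else 0) := by
      by_cases hy : y = 0
      · simp [hy]
      · rw [hb, zero_sub, ← neg_mul, map_mul, mul_assoc, ← sq, quadraticChar_sq_one hy]
        simp [hy]
    simp_rw [h2, ← Finset.mul_sum, Finset.sum_sub_distrib]
    simp [hb]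
  · have h3 := jacobiSum_nontrivial_inv (quadraticChar_ne_one hF)
    rw [(quadraticChar_isQuadratic F).inv, jacobiSum] at h3
    rw [← Equiv.sum_comp (Equiv.mulLeft₀ (b / w) (div_ne_zero hb hw))]
    have h4 (y : F) : quadraticChar F (b - w * (b / w * y)) * quadraticChar F (b / w * y) =
        quadraticChar F w * (quadraticChar F y * quadraticChar F (1 - y)) := by
      rw [← map_mul, ← map_mul, ← map_mul,
        show (b - w * (b / w * y)) * (b / w * y) = (b / w) ^ 2 * (w * (y * (1 - y))) by
          field_simp,
        map_mul, quadraticChar_sq_one' (div_ne_zero hb hw), one_mul]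
    simp only [Equiv.mulLeft₀_apply, h4, ← Finset.mul_sum, h3]
    rw [neg_eq_neg_one_mul w, map_mul]
    simp [hb, mul_comm]

theorem sum_fin_succ_quadraticForm (n : ℕ) (w : Fin (n + 1) → F) (b : F) :
    ∑ x : Fin (n + 1) → F, (if ∑ i, w i * x i ^ 2 = b then (1 : ℤ) else 0) =
      ∑ c : F, ∑ x : Fin n → F,
        if ∑ i, w i.succ * x i ^ 2 = b - w 0 * c ^ 2 then (1 : ℤ) else 0 := by
  rw [← Equiv.sum_comp (Fin.consEquiv fun _ => F), Fintype.sum_prod_type]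
  refine Finset.sum_congr rfl fun c _ => Finset.sum_congr rfl fun x _ => if_congr ?_ rfl rfl
  simp [Fin.consEquiv, Fin.sum_univ_succ, eq_sub_iff_add_eq, add_comm]

/-- One more variable turns the even-rank count into the odd-rank count. -/
theorem sum_even_rank_step (hF : ringChar F ≠ 2) {w : F} (hw : w ≠ 0) (A B : ℤ) (b : F) :
    ∑ c : F, (A + B * (Fintype.card F * (if b - w * c ^ 2 = 0 then 1 else 0) - 1)) =
      Fintype.card F * (A + B * quadraticChar F (w * b)) := by
  have h := sum_ite_mul_sq_eq hF hw b
  simp_rw [sub_eq_zero, Finset.sum_add_distrib, ← Finset.mul_sum, Finset.sum_sub_distrib,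
    ← Finset.mul_sum, h]
  simp
  ring

theorem card_mul_sum_diagonal (hF : ringChar F ≠ 2) (k : ℕ) (w : Fin (2 * k) → F)
    (hw : ∀ i, w i ≠ 0) (b : F) :
    Fintype.card F * ∑ x : Fin (2 * k) → F, (if ∑ i, w i * x i ^ 2 = b then (1 : ℤ) else 0) =
      (Fintype.card F : ℤ) ^ (2 * k) +
        (Fintype.card F : ℤ) ^ k * quadraticChar F ((-1) ^ k * ∏ i, w i) *
          (Fintype.card F * (if b = 0 then 1 else 0) - 1) := by
  induction k generalizing b with
  | zero => simp [eq_comm]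
  | succ k ih =>
    have hq : (Fintype.card F : ℤ) ≠ 0 := by simp
    have hodd (b : F) : ∑ x : Fin (2 * k + 1) → F,
        (if ∑ i, w i.succ * x i ^ 2 = b then (1 : ℤ) else 0) =
        (Fintype.card F : ℤ) ^ (2 * k) + (Fintype.card F : ℤ) ^ k *
          quadraticChar F ((-1) ^ k * ∏ i : Fin (2 * k), w i.succ.succ) *
            quadraticChar F (w 1 * b) := by
      apply mul_left_cancel₀ hq
      rw [sum_fin_succ_quadraticForm (2 * k) (fun i => w i.succ), Finset.mul_sum]
      simp_rw [ih (fun i => w i.succ.succ) (fun i => hw _)]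
      exact sum_even_rank_step hF (hw _) _ _ b
    change Fintype.card F * ∑ x : Fin (2 * k + 1 + 1) → F,
      (if ∑ i : Fin (2 * k + 1 + 1), w i * x i ^ 2 = b then (1 : ℤ) else 0) =
      (Fintype.card F : ℤ) ^ (2 * (k + 1)) + (Fintype.card F : ℤ) ^ (k + 1) *
        quadraticChar F ((-1) ^ (k + 1) * ∏ i : Fin (2 * k + 1 + 1), w i) *
          (Fintype.card F * (if b = 0 then 1 else 0) - 1)
    rw [sum_fin_succ_quadraticForm (2 * k + 1) w]
    simp_rw [hodd, Finset.sum_add_distrib, ← Finset.mul_sum, map_mul _ (w 1), ← Finset.mul_sum,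
      sum_quadraticChar_sub_mul_sq hF (hw 0)]
    rw [Fin.prod_univ_succ, Fin.prod_univ_succ, neg_eq_neg_one_mul (w 0)]
    simp only [map_mul, map_pow, Finset.sum_const, Finset.card_univ, nsmul_eq_mul, Fin.succ_zero_eq_one]
    ring

theorem card_mul_sum_symm (hF : ringChar F ≠ 2) (k : ℕ)
    (S : Matrix (Fin (2 * k)) (Fin (2 * k)) F) (hS : S.IsSymm) (hdet : S.det ≠ 0) (b : F) :
    Fintype.card F * ∑ x : Fin (2 * k) → F, (if x ⬝ᵥ S.mulVec x = b then (1 : ℤ) else 0) =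
      (Fintype.card F : ℤ) ^ (2 * k) +
        (Fintype.card F : ℤ) ^ k * quadraticChar F ((-1) ^ k * S.det) *
          (Fintype.card F * (if b = 0 then 1 else 0) - 1) := by
  obtain ⟨P, w, hP, h⟩ := exists_diagonalization hF S hS
  have hd : ∏ i, w i = P.det ^ 2 * S.det := by
    rw [← Matrix.det_diagonal, ← h, Matrix.det_mul, Matrix.det_mul, Matrix.det_transpose]
    ring
  have hw (i) : w i ≠ 0 := by
    have : ∏ i, w i ≠ 0 := by rw [hd]; exact mul_ne_zero (pow_ne_zero _ hP.ne_zero) hdet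
    exact Finset.prod_ne_zero_iff.1 this i (Finset.mem_univ _)
  have hχ : quadraticChar F ((-1) ^ k * ∏ i, w i) = quadraticChar F ((-1) ^ k * S.det) := by
    rw [hd, mul_left_comm, map_mul, quadraticChar_sq_one' hP.ne_zero, one_mul]
  rw [← hχ, ← card_mul_sum_diagonal hF k w hw b]
  congr 1
  have hbij : Function.Bijective P.mulVec :=
    have hP' := (Matrix.isUnit_iff_isUnit_det P).2 hP
    ⟨Matrix.mulVec_injective_iff_isUnit.2 hP', Matrix.mulVec_surjective_iff_isUnit.2 hP'⟩
  rw [← Equiv.sum_comp (Equiv.ofBijective _ hbij)]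
  refine Finset.sum_congr rfl fun x _ => if_congr ?_ rfl rfl
  have : (P.mulVec x) ⬝ᵥ S.mulVec (P.mulVec x) = ∑ i, w i * x i ^ 2 := by
    have hPS : (P.mulVec x) ⬝ᵥ S.mulVec (P.mulVec x) = x ⬝ᵥ (Pᵀ * S * P).mulVec x := by
      simp only [Matrix.dotProduct_mulVec, ← Matrix.vecMul_vecMul, Matrix.vecMul_transpose]
    rw [hPS, h]
    simp only [dotProduct, Matrix.mulVec_diagonal]
    exact Finset.sum_congr rfl fun i _ => by ring
  rw [Equiv.ofBijective_apply, this]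

theorem sum_symm_add_sq (hF : ringChar F ≠ 2) (k : ℕ)
    (S : Matrix (Fin (2 * k)) (Fin (2 * k)) F) (hS : S.IsSymm) (hdet : S.det ≠ 0)
    {w : F} (hw : w ≠ 0) (b : F) :
    ∑ x : (Fin (2 * k) → F) × F,
      (if x.1 ⬝ᵥ S.mulVec x.1 + w * x.2 ^ 2 = b then (1 : ℤ) else 0) =
      (Fintype.card F : ℤ) ^ (2 * k) +
        (Fintype.card F : ℤ) ^ k * quadraticChar F ((-1) ^ k * S.det * (w * b)) := by
  have hq : (Fintype.card F : ℤ) ≠ 0 := by simp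
  apply mul_left_cancel₀ hq
  rw [Fintype.sum_prod_type_right, Finset.mul_sum]
  simp_rw [← eq_sub_iff_add_eq, card_mul_sum_symm hF k S hS hdet]
  rw [sum_even_rank_step hF hw, map_mul _ _ (w * b), mul_assoc]

end FiniteField

theorem card_mul_card_filter_comp {G H : Type*} [AddGroup G] [AddGroup H] [Fintype G] [Fintype H]
    [DecidableEq H] (φ : G →+ H) (hφ : Function.Surjective φ) (q : H → Prop) [DecidablePred q] :
    Fintype.card H * (Finset.univ.filter fun g => q (φ g)).card =
      Fintype.card G * (Finset.univ.filter q).card := by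
  have hfib (h : H) : (Finset.univ.filter fun g => φ g = h).card =
      (Finset.univ.filter fun g => φ g = 0).card :=
    AddMonoidHom.card_fiber_eq_of_mem_range φ (hφ h) (hφ 0)
  have hG : Fintype.card G =
      Fintype.card H * (Finset.univ.filter fun g => φ g = 0).card := by
    rw [← Finset.card_univ, Finset.card_eq_sum_card_fiberwise (t := Finset.univ) (f := φ)
      (fun _ _ => Finset.mem_univ _)]
    simp [hfib]
  have hs : (Finset.univ.filter fun g => q (φ g)).card =
      (Finset.univ.filter q).card * (Finset.univ.filter fun g => φ g = 0).card := by
    rw [Finset.card_eq_sum_card_fiberwise (t := Finset.univ.filter q) (f := φ)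
      (fun g hg => by simpa using hg), Finset.sum_const_nat]
    intro h hh
    rw [← hfib h, Finset.filter_filter]
    congr 1
    ext g
    simp only [Finset.mem_filter, Finset.mem_univ, true_and] at hh ⊢
    exact ⟨fun h => h.2, fun h => ⟨h ▸ hh, h⟩⟩
  rw [hs, hG]
  ring

/-- Units congruent to `1` modulo an odd prime `p` are squares modulo `p ^ ν`. -/
theorem exists_sq_eq_of_dvd_sub_one {p ν : ℕ} [Fact p.Prime] (hp2 : p ≠ 2) {u : ZMod (p ^ ν)}
    (hu : (p : ZMod (p ^ ν)) ∣ u - 1) : ∃ s : (ZMod (p ^ ν))ˣ, (s : ZMod (p ^ ν)) ^ 2 = u := by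
  have h1 : u ^ p ^ ν = 1 := by
    have h := dvd_sub_pow_of_dvd_sub hu ν
    have h0 : (p : ZMod (p ^ ν)) ^ ν = 0 := by
      rw [← Nat.cast_pow, ZMod.natCast_self]
    rw [pow_succ, h0, zero_mul, zero_dvd_iff, one_pow, sub_eq_zero] at h
    exact h
  obtain ⟨m, hm⟩ : Odd (p ^ ν) := ((Fact.out : p.Prime).odd_of_ne_two hp2).pow
  have hunit : IsUnit u := IsUnit.of_pow_eq_one h1 (pow_ne_zero _ (Fact.out : p.Prime).ne_zero)
  refine ⟨hunit.unit ^ (m + 1), ?_⟩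
  rw [Units.val_pow_eq_pow_val, IsUnit.unit_spec, ← pow_mul,
    show (m + 1) * 2 = p ^ ν + 1 by omega, pow_succ, h1, one_mul]

theorem dvd_iff_castHom_eq_zero {p ν : ℕ} (h : p ∣ p ^ ν) (a : ZMod (p ^ ν)) :
    (p : ZMod (p ^ ν)) ∣ a ↔ ZMod.castHom h (ZMod p) a = 0 := by
  constructor
  · rintro ⟨b, rfl⟩
    rw [map_mul, map_natCast, ZMod.natCast_self, zero_mul]
  · obtain ⟨n, rfl⟩ := ZMod.intCast_surjective a
    rw [map_intCast, ZMod.intCast_zmod_eq_zero_iff_dvd]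
    rintro ⟨m, rfl⟩
    exact ⟨m, by push_cast; rfl⟩

theorem card_filter_eq_of_castHom_eq {p ν : ℕ} [Fact p.Prime] (hp2 : p ≠ 2) (h : p ∣ p ^ ν)
    {M : Type*} [AddCommGroup M] [Module (ZMod (p ^ ν)) M] [Fintype M]
    (f : M → ZMod (p ^ ν)) (hf : ∀ (a : ZMod (p ^ ν)) x, f (a • x) = a ^ 2 * f x)
    {c d : ZMod (p ^ ν)} (hc : IsUnit c)
    (hcd : ZMod.castHom h (ZMod p) d = ZMod.castHom h (ZMod p) c) :
    (Finset.univ.filter fun x => f x = d).card = (Finset.univ.filter fun x => f x = c).card := by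
  obtain ⟨c, rfl⟩ := hc
  obtain ⟨s, hs⟩ : ∃ s : (ZMod (p ^ ν))ˣ, (s : ZMod (p ^ ν)) ^ 2 = d * (c⁻¹ : (ZMod (p ^ ν))ˣ) := by
    refine exists_sq_eq_of_dvd_sub_one hp2 ?_
    rw [dvd_iff_castHom_eq_zero h, map_sub, map_mul, hcd, ← map_mul, Units.mul_inv, sub_self]
  refine Finset.card_bij' (fun x _ => s⁻¹ • x) (fun x _ => s • x) ?_ ?_ ?_ ?_
  · intro x hx
    simp only [Finset.mem_filter, Finset.mem_univ, true_and] at hx ⊢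
    have hd : d = (s : ZMod (p ^ ν)) ^ 2 * c := by rw [hs, mul_assoc, Units.inv_mul, mul_one]
    rw [Units.smul_def, hf, hx, hd, ← mul_assoc, ← mul_pow, Units.inv_mul, one_pow, one_mul]
  · intro x hx
    simp only [Finset.mem_filter, Finset.mem_univ, true_and] at hx ⊢
    rw [Units.smul_def, hf, hx, hs, mul_assoc, Units.inv_mul, mul_one]
  · intro x _; simp
  · intro x _; simp

theorem card_quadratic_lift {p ν : ℕ} [Fact p.Prime] (hp2 : p ≠ 2) (h : p ∣ p ^ ν)
    {M N : Type*} [AddCommGroup M] [Module (ZMod (p ^ ν)) M] [Fintype M]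
    [AddCommGroup N] [Fintype N] [DecidableEq N] (φ : M →+ N) (hφ : Function.Surjective φ)
    (f : M → ZMod (p ^ ν)) (hf : ∀ (a : ZMod (p ^ ν)) x, f (a • x) = a ^ 2 * f x)
    (g : N → ZMod p) (hfg : ∀ x, g (φ x) = ZMod.castHom h (ZMod p) (f x))
    {c : ZMod (p ^ ν)} (hc : IsUnit c) :
    Fintype.card N * p ^ ν * (Finset.univ.filter fun x => f x = c).card =
      p * Fintype.card M *
        (Finset.univ.filter fun y => g y = ZMod.castHom h (ZMod p) c).card := by
  set c' := ZMod.castHom h (ZMod p) c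
  have hR := card_mul_card_filter_comp (ZMod.castHom h (ZMod p)).toAddMonoidHom
    (ZMod.castHom_surjective h) (fun y => y = c')
  have hM := card_mul_card_filter_comp φ hφ (fun y => g y = c')
  have hsum : (Finset.univ.filter fun x => g (φ x) = c').card =
      (Finset.univ.filter fun d => ZMod.castHom h (ZMod p) d = c').card *
        (Finset.univ.filter fun x => f x = c).card := by
    rw [Finset.card_eq_sum_card_fiberwise
      (t := Finset.univ.filter fun d => ZMod.castHom h (ZMod p) d = c') (f := f)
      (fun x hx => Finset.mem_coe.2 (Finset.mem_filter.2
        ⟨Finset.mem_univ _, (hfg x).symm.trans (Finset.mem_filter.1 hx).2⟩)), Finset.sum_const_nat]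
    intro d hd
    simp only [Finset.mem_filter, Finset.mem_univ, true_and] at hd
    rw [← card_filter_eq_of_castHom_eq hp2 h f hf hc hd, Finset.filter_filter]
    congr 1
    ext x
    simp only [Finset.mem_filter, Finset.mem_univ, true_and]
    exact ⟨fun h => h.2, fun h => ⟨by rw [hfg, h, hd], h⟩⟩
  simp only [ZMod.card, Finset.filter_eq', Finset.mem_univ, if_true, Finset.card_singleton, mul_one,
    RingHom.toAddMonoidHom_eq_coe, AddMonoidHom.coe_coe] at hR
  rw [mul_assoc p, ← hM, hsum]
  linear_combination (Fintype.card N * (Finset.univ.filter fun x => f x = c).card) * hR.symm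

/-- Let `p` be an odd prime, `e ≥ 2` even, `S` a symmetric `e×e` integer matrix with even
diagonal, and `m', t` integers with `p ∤ det S`, `p ∤ m'`, `p ∤ t`. Then for every `ν ≥ 1`,
the number of `(v,λ) ∈ (ℤ/p^νℤ)^e × (ℤ/p^νℤ)` with `vᵀSv + 2m'λ² + 2t ≡ 0 (mod p^ν)`
equals `p^{νe} + ε·p^{νe − e/2}`, with `ε` the Legendre symbol of
`(−1)^{e/2+1}·m'·t·det S` mod `p`. -/
theorem count_solutions_even_rank (p : ℕ) [Fact p.Prime] (hp2 : p ≠ 2)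
    (e : ℕ) (he : 2 ≤ e) (heven : Even e)
    (S : Matrix (Fin e) (Fin e) ℤ) (hsym : S.IsSymm) (hdiag : ∀ i, Even (S i i))
    (m' t : ℤ) (hdet : ¬ (p : ℤ) ∣ S.det) (hm : ¬ (p : ℤ) ∣ m') (ht : ¬ (p : ℤ) ∣ t)
    (ν : ℕ) (hν : 1 ≤ ν) :
    (Nat.card {x : (Fin e → ZMod (p ^ ν)) × ZMod (p ^ ν) //
        x.1 ⬝ᵥ (S.map (Int.cast : ℤ → ZMod (p ^ ν))).mulVec x.1
          + 2 * (m' : ZMod (p ^ ν)) * x.2 ^ 2 + 2 * (t : ZMod (p ^ ν)) = 0} : ℤ) =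
      (p : ℤ) ^ (ν * e) +
        legendreSym p ((-1) ^ (e / 2 + 1) * m' * t * S.det) * (p : ℤ) ^ (ν * e - e / 2) := by
  obtain ⟨k, hk⟩ := heven
  obtain rfl : e = 2 * k := by omega
  have hp : p.Prime := Fact.out
  have hF : ringChar (ZMod p) ≠ 2 := by rwa [ZMod.ringChar_zmod_n]
  have h : p ∣ p ^ ν := dvd_pow_self p (by omega)
  have h0 {a : ℤ} (ha : ¬ (p : ℤ) ∣ a) : (a : ZMod p) ≠ 0 := fun h =>
    ha ((ZMod.intCast_zmod_eq_zero_iff_dvd a p).1 h)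
  have h2 : (2 : ZMod p) ≠ 0 := Ring.two_ne_zero hF
  let π := ZMod.castHom h (ZMod p)
  have hπ2 : π 2 = 2 := map_ofNat π 2
  let φ : ((Fin (2 * k) → ZMod (p ^ ν)) × ZMod (p ^ ν)) →+ ((Fin (2 * k) → ZMod p) × ZMod p) :=
    AddMonoidHom.prodMap (π.toAddMonoidHom.compLeft (Fin (2 * k))) π.toAddMonoidHom
  have hφ : Function.Surjective φ :=
    Function.Surjective.prodMap (ZMod.castHom_surjective h).comp_left (ZMod.castHom_surjective h)
  let f (x : (Fin (2 * k) → ZMod (p ^ ν)) × ZMod (p ^ ν)) : ZMod (p ^ ν) :=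
    x.1 ⬝ᵥ (S.map (Int.cast : ℤ → ZMod (p ^ ν))).mulVec x.1 + 2 * (m' : ZMod (p ^ ν)) * x.2 ^ 2
  let g (x : (Fin (2 * k) → ZMod p) × ZMod p) : ZMod p :=
    x.1 ⬝ᵥ (S.map (Int.cast : ℤ → ZMod p)).mulVec x.1 + 2 * (m' : ZMod p) * x.2 ^ 2
  have hf (a : ZMod (p ^ ν)) (x) : f (a • x) = a ^ 2 * f x := by
    simp only [f, Prod.smul_fst, Prod.smul_snd, Matrix.mulVec_smul, smul_dotProduct,
      dotProduct_smul, smul_eq_mul]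
    ring
  have hfg (x) : g (φ x) = π (f x) := by
    simp [f, g, φ, dotProduct, Matrix.mulVec, map_sum, hπ2]
  have hc : IsUnit (-(2 * (t : ZMod (p ^ ν)))) := by
    have h2t : IsCoprime (2 * t) (p : ℤ) := by
      rw [isCoprime_comm, (Nat.prime_iff_prime_int.1 hp).coprime_iff_not_dvd,
        ← ZMod.intCast_zmod_eq_zero_iff_dvd]
      push_cast
      exact mul_ne_zero h2 (h0 ht)
    have := (ZMod.coe_int_isUnit_iff_isCoprime (2 * t) (p ^ ν)).2 (by
      push_cast; exact h2t.symm.pow_left)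
    push_cast at this
    exact this.neg
  have hlift := card_quadratic_lift hp2 h φ hφ f hf g hfg hc
  have hπ : π (-(2 * (t : ZMod (p ^ ν)))) = -(2 * (t : ZMod p)) := by
    rw [map_neg, map_mul, hπ2, map_intCast]
  change _ = _ * (Finset.univ.filter fun y => g y = π _).card at hlift
  rw [hπ] at hlift
  have hdet' : (S.map (Int.cast : ℤ → ZMod p)).det = (S.det : ZMod p) :=
    (Int.cast_det S).symm
  have hcount := sum_symm_add_sq hF k (S.map (Int.cast : ℤ → ZMod p)) (hsym.map _)
    (by rw [hdet']; exact h0 hdet) (mul_ne_zero h2 (h0 hm)) (-(2 * (t : ZMod p)))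
  rw [Finset.sum_boole, hdet'] at hcount
  have hχ : quadraticChar (ZMod p)
      ((-1) ^ k * (S.det : ZMod p) * (2 * (m' : ZMod p) * -(2 * (t : ZMod p)))) =
      legendreSym p ((-1) ^ (2 * k / 2 + 1) * m' * t * S.det) := by
    rw [legendreSym, Nat.mul_div_cancel_left k two_pos]
    push_cast
    rw [← one_mul (quadraticChar (ZMod p) ((-1) ^ (k + 1) * _ * _ * _)),
      ← quadraticChar_sq_one' h2, ← map_mul]
    congr 1
    ring
  rw [hχ, ZMod.card] at hcount
  have hN : Nat.card {x : (Fin (2 * k) → ZMod (p ^ ν)) × ZMod (p ^ ν) // f x + 2 * t = 0} =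
      (Finset.univ.filter fun x => f x = -(2 * (t : ZMod (p ^ ν)))).card := by
    rw [Nat.card_eq_fintype_card, Fintype.card_subtype]
    simp_rw [eq_neg_iff_add_eq_zero]
  change ((Nat.card {x : (Fin (2 * k) → ZMod (p ^ ν)) × ZMod (p ^ ν) // f x + 2 * t = 0} : ℕ) : ℤ)
    = _
  rw [hN]
  have hlift' := congrArg (Nat.cast : ℕ → ℤ) hlift
  simp only [Nat.cast_mul, Fintype.card_prod, Fintype.card_pi, ZMod.card, Finset.prod_const,
    Finset.card_univ, Fintype.card_fin, Nat.cast_pow, g] at hlift'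
  rw [hcount] at hlift'
  have hp0 : (p : ℤ) ≠ 0 := by exact_mod_cast hp.ne_zero
  have hne : (p : ℤ) ^ (2 * k) * p * p ^ ν ≠ 0 := by positivity
  apply mul_left_cancel₀ hne
  rw [hlift', Nat.mul_div_cancel_left k two_pos]
  have hpow : (p : ℤ) ^ (ν * (2 * k)) * p ^ k = p ^ (2 * k) * p ^ (ν * (2 * k) - k) := by
    rw [← pow_add, ← pow_add]
    congr 1
    have : 1 * (2 * k) ≤ ν * (2 * k) := Nat.mul_le_mul_right _ hν
    omega
  rw [← pow_mul]
  linear_combination (p : ℤ) * p ^ ν *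
    legendreSym p ((-1) ^ (k + 1) * m' * t * S.det) * hpow
end

section
/- Let p be an odd prime, let e ≥ 1 be an odd integer, let S be a symmetric e×e integer matrix with even diagonal entries, and let m', t be integers such that p ∤ det S, p ∤ m', and p ∤ t. Then for every integer ν ≥ 1, #{(v,λ) ∈ (ℤ/p^νℤ)^e × (ℤ/p^νℤ) : vᵀSv + 2m'λ² + 2t ≡ 0 (mod p^ν)} = p^{νe} − ε·p^{νe − (e+1)/2}, where ε is the Legendre symbol of (−1)^{(e+1)/2}·2·m'·det S modulo p. -/
open Matrix

/-- The number of points of `X` at which `f` takes the value `c`, as an integer. -/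
def fiberCard {X F : Type*} [Fintype X] [DecidableEq F] (f : X → F) (c : F) : ℤ :=
  ∑ x, if f x = c then 1 else 0

theorem fiberCard_eq_natCard {X F : Type*} [Fintype X] [DecidableEq F] (f : X → F) (c : F) :
    fiberCard f c = Nat.card {x // f x = c} := by
  rw [Nat.card_eq_fintype_card, Fintype.card_subtype, fiberCard, Finset.sum_boole]

theorem fiberCard_comp_equiv {X Y F : Type*} [Fintype X] [Fintype Y] [DecidableEq F]
    (σ : Y ≃ X) (f : X → F) (c : F) : fiberCard (fun y => f (σ y)) c = fiberCard f c :=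
  Equiv.sum_comp σ fun x => if f x = c then (1 : ℤ) else 0

theorem fiberCard_add {X Y F : Type*} [Fintype X] [Fintype Y] [Fintype F] [DecidableEq F]
    [AddCommGroup F] (f : X → F) (g : Y → F) (c : F) :
    fiberCard (fun z : X × Y => f z.1 + g z.2) c
      = ∑ u, fiberCard f u * fiberCard g (c - u) := by
  simp only [fiberCard, Fintype.sum_prod_type, Finset.sum_mul_sum]
  refine Eq.trans ?_ Finset.sum_comm
  refine Finset.sum_congr rfl fun x _ => ?_
  rw [Finset.sum_comm]
  refine Finset.sum_congr rfl fun y _ => ?_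
  rw [Finset.sum_eq_single (f x) (fun u _ hu => by simp [hu.symm]) (by simp)]
  simp [eq_sub_iff_add_eq, add_comm]

section FiniteField

variable {F : Type*} [Field F] [Fintype F] [DecidableEq F]

theorem fiberCard_mul_sq (hF : ringChar F ≠ 2) {a : F} (ha : a ≠ 0) (u : F) :
    fiberCard (fun x : F => a * x ^ 2) u = quadraticChar F a * quadraticChar F u + 1 := by
  have h := quadraticChar_card_sqrts hF (a * u * (a⁻¹) ^ 2)
  rw [map_mul, map_mul, quadraticChar_sq_one' (inv_ne_zero ha), mul_one] at h
  rw [← h, fiberCard, Finset.sum_boole]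
  congr 2
  ext x
  simp only [Finset.mem_filter, Finset.mem_univ, true_and, Set.mem_toFinset, Set.mem_ofPred_eq]
  constructor
  · rintro rfl
    field_simp
  · intro h
    rw [h]
    field_simp

theorem sum_quadraticChar_mul_quadraticChar_sub (hF : ringChar F ≠ 2) (c : F) :
    ∑ u : F, quadraticChar F u * quadraticChar F (c - u)
      = quadraticChar F (-1) * ((if c = 0 then (Fintype.card F : ℤ) else 0) - 1) := by
  by_cases hc : c = 0
  · subst hc
    have h (u : F) : quadraticChar F u * quadraticChar F (0 - u)
        = quadraticChar F (-1) * (1 - if u = 0 then 1 else 0) := by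
      by_cases hu : u = 0
      · simp [hu]
      · rw [zero_sub, ← neg_one_mul u, map_mul, if_neg hu]
        linear_combination quadraticChar F (-1) * quadraticChar_sq_one hu
    simp only [h, ← Finset.mul_sum, Finset.sum_sub_distrib]
    simp
  · have h := jacobiSum_nontrivial_inv (quadraticChar_ne_one hF)
    rw [(quadraticChar_isQuadratic F).inv, jacobiSum] at h
    rw [← Equiv.sum_comp (Equiv.mulLeft₀ c hc)]
    have h' (u : F) : quadraticChar F (Equiv.mulLeft₀ c hc u)
        * quadraticChar F (c - Equiv.mulLeft₀ c hc u)
        = quadraticChar F u * quadraticChar F (1 - u) := by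
      have : c - c * u = c * (1 - u) := by ring
      rw [Equiv.mulLeft₀_apply, this, map_mul, map_mul]
      linear_combination quadraticChar F u * quadraticChar F (1 - u) * quadraticChar_sq_one hc
    simp only [h', h, if_neg hc]
    ring

theorem fiberCard_binary_form (hF : ringChar F ≠ 2) {a b : F} (ha : a ≠ 0) (hb : b ≠ 0) (c : F) :
    fiberCard (fun x : F × F => a * x.1 ^ 2 + b * x.2 ^ 2) c
      = Fintype.card F + quadraticChar F (-1 * (a * b))
        * ((if c = 0 then (Fintype.card F : ℤ) else 0) - 1) := by
  rw [fiberCard_add (fun x : F => a * x ^ 2) (fun x : F => b * x ^ 2)]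
  simp only [fiberCard_mul_sq hF ha, fiberCard_mul_sq hF hb]
  have h0 := quadraticChar_sum_zero hF
  have h1 : ∑ u : F, quadraticChar F (c - u) = 0 := by
    rw [← h0]
    exact Equiv.sum_comp (Equiv.subLeft c) _
  have h2 (u : F) : (quadraticChar F a * quadraticChar F u + 1)
      * (quadraticChar F b * quadraticChar F (c - u) + 1)
      = quadraticChar F a * quadraticChar F b * (quadraticChar F u * quadraticChar F (c - u))
        + quadraticChar F a * quadraticChar F u + quadraticChar F b * quadraticChar F (c - u)
        + 1 := by ring
  simp only [h2, Finset.sum_add_distrib, ← Finset.mul_sum, h0, h1,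
    sum_quadraticChar_mul_quadraticChar_sub hF, map_mul]
  simp
  ring

theorem card_mul_fiberCard_sum_mul_sq_fin (hF : ringChar F ≠ 2) (k : ℕ) (a : Fin (2 * k) → F)
    (ha : ∀ i, a i ≠ 0) (c : F) :
    Fintype.card F * fiberCard (fun x : Fin (2 * k) → F => ∑ i, a i * x i ^ 2) c
      = (Fintype.card F : ℤ) ^ (2 * k) + quadraticChar F ((-1) ^ k * ∏ i, a i)
        * (Fintype.card F : ℤ) ^ k * ((if c = 0 then (Fintype.card F : ℤ) else 0) - 1) := by
  induction k generalizing c with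
  | zero => simp [fiberCard, eq_comm]
  | succ k ih =>
    change Fin (2 * k + 1 + 1) → F at a
    let σ : (F × F) × (Fin (2 * k) → F) ≃ (Fin (2 * k + 1 + 1) → F) :=
      (Equiv.prodAssoc F F _).trans <|
        ((Equiv.refl F).prodCongr (Fin.consEquiv fun _ : Fin (2 * k + 1) => F)).trans
          (Fin.consEquiv fun _ : Fin (2 * k + 1 + 1) => F)
    have hσ (z : (F × F) × (Fin (2 * k) → F)) : ∑ i, a i * σ z i ^ 2
        = (a 0 * z.1.1 ^ 2 + a 1 * z.1.2 ^ 2) + ∑ i : Fin (2 * k), a i.succ.succ * z.2 i ^ 2 := by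
      rw [Fin.sum_univ_succ, Fin.sum_univ_succ, ← add_assoc]
      rfl
    have hfib := fiberCard_comp_equiv σ (fun x => ∑ i, a i * x i ^ 2) c
    simp only [hσ] at hfib
    rw [fiberCard_add (fun x : F × F => a 0 * x.1 ^ 2 + a 1 * x.2 ^ 2)
      (fun y : Fin (2 * k) → F => ∑ i, a i.succ.succ * y i ^ 2)] at hfib
    change _ * fiberCard (fun x : Fin (2 * k + 1 + 1) → F => ∑ i, a i * x i ^ 2) c =
      _ + quadraticChar F (_ * ∏ i : Fin (2 * k + 1 + 1), a i) * _ * _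
    have hprod : (-1) ^ (k + 1) * ∏ i, a i
        = (-1 * (a 0 * a 1)) * ((-1) ^ k * ∏ i : Fin (2 * k), a i.succ.succ) := by
      rw [Fin.prod_univ_succ, Fin.prod_univ_succ, Fin.succ_zero_eq_one]
      ring
    rw [← hfib, hprod, map_mul, Finset.mul_sum]
    simp only [mul_left_comm (Fintype.card F : ℤ), ih (fun i => a i.succ.succ) (fun i => ha _),
      fiberCard_binary_form hF (ha 0) (ha 1)]
    set q : ℤ := (Fintype.card F : ℤ) with hq
    set s := quadraticChar F (-1 * (a 0 * a 1))
    set r := quadraticChar F ((-1) ^ k * ∏ i : Fin (2 * k), a i.succ.succ)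
    have hexp (u : F) : (q + s * ((if u = 0 then q else 0) - 1))
        * (q ^ (2 * k) + r * q ^ k * ((if c - u = 0 then q else 0) - 1))
        = (q - s) * (q ^ (2 * k) - r * q ^ k)
          + (if u = 0 then s * q * (q ^ (2 * k) + r * q ^ k * ((if c = 0 then q else 0) - 1))
              else 0)
          + (if c = u then (q - s) * (r * q ^ k) * q else 0) := by
      simp only [sub_eq_zero]
      by_cases hu : u = 0
      · subst hu
        split_ifs <;> ring
      · split_ifs <;> ring
    simp only [hexp, Finset.sum_add_distrib, Finset.sum_ite_eq, Finset.sum_ite_eq',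
      Finset.mem_univ, if_true, Finset.sum_const, Finset.card_univ, nsmul_eq_mul, ← hq]
    ring

theorem card_mul_fiberCard_sum_mul_sq (hF : ringChar F ≠ 2) {ι : Type*} [Fintype ι]
    [DecidableEq ι] {k : ℕ} (hι : Fintype.card ι = 2 * k) (a : ι → F) (ha : ∀ i, a i ≠ 0) (c : F) :
    Fintype.card F * fiberCard (fun x : ι → F => ∑ i, a i * x i ^ 2) c
      = (Fintype.card F : ℤ) ^ (2 * k) + quadraticChar F ((-1) ^ k * ∏ i, a i)
        * (Fintype.card F : ℤ) ^ k * ((if c = 0 then (Fintype.card F : ℤ) else 0) - 1) := by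
  let τ : Fin (2 * k) ≃ ι := (Fintype.equivFinOfCardEq hι).symm
  have h := card_mul_fiberCard_sum_mul_sq_fin hF k (a ∘ τ) (fun i => ha _) c
  have h2 := fiberCard_comp_equiv (τ.arrowCongr (Equiv.refl F)).symm
    (fun x : Fin (2 * k) → F => ∑ i, (a ∘ τ) i * x i ^ 2) c
  have h3 (x : ι → F) : ∑ i, (a ∘ τ) i * ((τ.arrowCongr (Equiv.refl F)).symm x) i ^ 2
      = ∑ i, a i * x i ^ 2 := Equiv.sum_comp τ fun i => a i * x i ^ 2
  have h4 : ∏ i, (a ∘ τ) i = ∏ i, a i := Equiv.prod_comp τ a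
  simp only [h3] at h2
  rw [h2, h, h4]

theorem card_mul_fiberCard_dotProduct_mulVec (hF : ringChar F ≠ 2) {ι : Type*} [Fintype ι]
    [DecidableEq ι] {k : ℕ} (hι : Fintype.card ι = 2 * k) {M : Matrix ι ι F} (hM : M.IsSymm)
    (hdet : M.det ≠ 0) (c : F) :
    Fintype.card F * fiberCard (fun x : ι → F => x ⬝ᵥ M *ᵥ x) c
      = (Fintype.card F : ℤ) ^ (2 * k) + quadraticChar F ((-1) ^ k * M.det)
        * (Fintype.card F : ℤ) ^ k * ((if c = 0 then (Fintype.card F : ℤ) else 0) - 1) := by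
  have : Invertible (2 : F) := invertibleOfNonzero (Ring.two_ne_zero hF)
  obtain ⟨w, hw⟩ := LinearMap.BilinForm.exists_orthogonal_basis
    (LinearMap.BilinForm.isSymm_iff.mp (Matrix.isSymm_toBilin'_iff_isSymm.mpr hM))
  have hcard : Fintype.card (Fin (Module.finrank F (ι → F))) = Fintype.card ι := by simp
  let v : Module.Basis ι F (ι → F) := w.reindex (Fintype.equivOfCardEq hcard)
  have hv (i j : ι) (hij : i ≠ j) : M.toBilin' (v i) (v j) = 0 := by
    simp only [v, Module.Basis.reindex_apply]
    exact hw (by simpa using hij)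
  let a (i : ι) : F := M.toBilin' (v i) (v i)
  have hdiag : LinearMap.BilinForm.toMatrix v M.toBilin' = Matrix.diagonal a := by
    ext i j
    rw [LinearMap.BilinForm.toMatrix_apply]
    by_cases hij : i = j
    · subst hij
      simp [a]
    · rw [hv i j hij, Matrix.diagonal_apply_ne _ hij]
  let P := (Pi.basisFun F ι).toMatrix v
  have hP : Pᵀ * M * P = Matrix.diagonal a := by
    rw [← hdiag, ← LinearMap.BilinForm.toMatrix_mul_basis_toMatrix (Pi.basisFun F ι) v,
      LinearMap.BilinForm.toMatrix_basisFun, LinearMap.BilinForm.toMatrix'_toBilin']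
  have hPdet : P.det ≠ 0 := by
    have : Invertible P := (Pi.basisFun F ι).invertibleToMatrix v
    exact (Matrix.isUnit_det_of_invertible P).ne_zero
  have hprod : ∏ i, a i = M.det * P.det ^ 2 := by
    rw [← Matrix.det_diagonal, ← hP]
    simp
    ring
  have ha : ∀ i, a i ≠ 0 := by
    have : ∏ i, a i ≠ 0 := by
      rw [hprod]
      exact mul_ne_zero hdet (pow_ne_zero _ hPdet)
    simpa [Finset.prod_ne_zero_iff] using this
  have hform (y : ι → F) : v.equivFun.symm y ⬝ᵥ M *ᵥ v.equivFun.symm y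
      = ∑ i, a i * y i ^ 2 := by
    rw [← Matrix.toBilin'_apply', ← LinearMap.BilinForm.dotProduct_toMatrix_mulVec v, hdiag]
    simp [dotProduct, Matrix.mulVec_diagonal]
    exact Finset.sum_congr rfl fun i _ => by ring
  have h := card_mul_fiberCard_sum_mul_sq hF hι a ha c
  simp only [← hform] at h
  have h2 := fiberCard_comp_equiv v.equivFun.symm.toEquiv (fun x : ι → F => x ⬝ᵥ M *ᵥ x) c
  simp only [LinearEquiv.coe_toEquiv] at h2
  rw [h2] at h
  rw [h, hprod, ← mul_assoc, map_mul, quadraticChar_sq_one' hPdet, mul_one]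

end FiniteField

theorem natCard_subtype_comp_of_surjective {X Y : Type*} [AddGroup X] [AddGroup Y] [Finite X] [Finite Y]
    (f : X →+ Y) (hf : Function.Surjective f) (A : Y → Prop) :
    Nat.card {x // A (f x)} = Nat.card {y // A y} * Nat.card f.ker := by
  have := Fintype.ofFinite {y // A y}
  rw [← Nat.card_congr (Equiv.sigmaSubtypeFiberEquivSubtype f (p := fun x => A (f x)) (q := A)
    fun _ => Iff.rfl), Nat.card_sigma]
  have h (y : {y // A y}) : Nat.card {x // f x = y} = Nat.card f.ker :=
    Nat.card_congr (f.fiberEquivKerOfSurjective hf y)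
  simp [h]

/-- If the kernel `G` of `Rˣ → Fˣ` has odd order, then every element of `G` is a square in `G`, and
scaling by `G` spreads the solutions of `x ⬝ᵥ M *ᵥ x = c` over those of the reduced equation. -/
theorem natCard_mul_natCard_ker_unitsMap {R F ι : Type*} [CommRing R] [CommRing F] [Fintype ι]
    (φ : R →+* F) [IsLocalHom φ] (hG : (Nat.card (Units.map (φ : R →* F)).ker).Coprime 2)
    (M : Matrix ι ι R) (c : Rˣ) :
    Nat.card {x : ι → R // x ⬝ᵥ M *ᵥ x = c} * Nat.card (Units.map (φ : R →* F)).ker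
      = Nat.card {x : ι → R // φ (x ⬝ᵥ M *ᵥ x) = φ c} := by
  have hscale (r : R) (x : ι → R) : (r • x) ⬝ᵥ M *ᵥ (r • x) = r ^ 2 * (x ⬝ᵥ M *ᵥ x) := by
    rw [Matrix.mulVec_smul, smul_dotProduct, dotProduct_smul, smul_eq_mul, smul_eq_mul]
    ring
  rw [← Nat.card_prod]
  refine Nat.card_congr (Equiv.ofBijective (fun z => ⟨(z.2 : Rˣ).val • z.1.1, ?_⟩) ⟨?_, ?_⟩)
  · have h : φ (z.2 : Rˣ).val = 1 := congrArg Units.val z.2.2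
    rw [hscale, z.1.2, map_mul, map_pow, h]
    ring
  · rintro ⟨⟨x, hx⟩, g⟩ ⟨⟨y, hy⟩, h⟩ hxy
    have hxy' : (g : Rˣ).val • x = (h : Rˣ).val • y := congrArg Subtype.val hxy
    have h2 : (g : Rˣ).val ^ 2 * c = (h : Rˣ).val ^ 2 * c := by
      rw [← hx, ← hscale, hxy', hscale, hy, hx]
    have hgh : g = h := by
      apply (powCoprime hG).injective
      apply Subtype.ext
      apply Units.ext
      simpa using h2
    subst hgh
    have : x = y := by
      have := congrArg (fun z => ((g : Rˣ)⁻¹).val • z) hxy'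
      simpa [smul_smul] using this
    subst this
    rfl
  · rintro ⟨x, hx⟩
    have hu : IsUnit (x ⬝ᵥ M *ᵥ x) := by
      refine isUnit_of_map_unit φ _ ?_
      rw [hx]
      exact c.isUnit.map φ
    obtain ⟨u, hu⟩ := hu
    have hker : u * c⁻¹ ∈ (Units.map (φ : R →* F)).ker := by
      rw [MonoidHom.mem_ker, map_mul, map_inv, mul_inv_eq_one]
      apply Units.ext
      simpa [hu] using hx
    obtain ⟨g, hg⟩ := (powCoprime hG).surjective ⟨u * c⁻¹, hker⟩
    have hg' : ((g : Rˣ) : R) ^ 2 * c = u := by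
      have := congrArg (fun z : (Units.map (φ : R →* F)).ker => ((z : Rˣ) * c : Rˣ)) hg
      simp only [powCoprime_apply, SubmonoidClass.coe_pow, inv_mul_cancel_right] at this
      simpa using congrArg Units.val this
    refine ⟨⟨⟨((g : Rˣ)⁻¹).val • x, ?_⟩, g⟩, ?_⟩
    · rw [hscale, ← hu, ← hg', ← mul_assoc, ← mul_pow]
      simp
    · simp [smul_smul]

theorem isLocalHom_castHom_prime_pow {p ν : ℕ} [Fact p.Prime] (hν : ν ≠ 0) :
    IsLocalHom (ZMod.castHom (dvd_pow_self p hν) (ZMod p)) := by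
  constructor
  intro a ha
  have : NeZero (p ^ ν) := ⟨pow_ne_zero _ (Fact.out : p.Prime).ne_zero⟩
  rw [← ZMod.natCast_zmod_val a] at ha ⊢
  rw [map_natCast, ZMod.isUnit_iff_coprime] at ha
  rw [ZMod.isUnit_iff_coprime]
  exact ha.pow_right ν

theorem natCard_ker_unitsMap_castHom {p ν : ℕ} [Fact p.Prime] (hν : ν ≠ 0) :
    Nat.card (Units.map (ZMod.castHom (dvd_pow_self p hν) (ZMod p) : ZMod (p ^ ν) →* ZMod p)).ker
      = p ^ (ν - 1) := by
  have hp : p.Prime := Fact.out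
  have : NeZero (p ^ ν) := ⟨pow_ne_zero _ hp.ne_zero⟩
  set f := Units.map (ZMod.castHom (dvd_pow_self p hν) (ZMod p) : ZMod (p ^ ν) →* ZMod p) with hf
  have hsurj : Function.Surjective f := ZMod.unitsMap_surjective (dvd_pow_self p hν)
  have h := f.ker.card_mul_index
  rw [Subgroup.index_ker, MonoidHom.range_eq_top.mpr hsurj, Subgroup.card_top,
    Nat.card_eq_fintype_card (α := (ZMod p)ˣ), Nat.card_eq_fintype_card (α := (ZMod (p ^ ν))ˣ),
    ZMod.card_units_eq_totient, ZMod.card_units_eq_totient,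
    Nat.totient_prime_pow hp (Nat.pos_of_ne_zero hν), Nat.totient_prime hp] at h
  exact Nat.eq_of_mul_eq_mul_right (Nat.sub_pos_of_lt hp.one_lt) h

theorem natCard_comp_castHom {p ν : ℕ} [Fact p.Prime] (hν : ν ≠ 0) {ι : Type*} [Fintype ι]
    (A : (ι → ZMod p) → Prop) :
    Nat.card {x : ι → ZMod (p ^ ν) //
        A fun i => ZMod.castHom (dvd_pow_self p hν) (ZMod p) (x i)}
      = Nat.card {y // A y} * p ^ ((ν - 1) * Fintype.card ι) := by
  have hp : p.Prime := Fact.out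
  have : NeZero (p ^ ν) := ⟨pow_ne_zero _ hp.ne_zero⟩
  let f : (ι → ZMod (p ^ ν)) →+ (ι → ZMod p) :=
    (ZMod.castHom (dvd_pow_self p hν) (ZMod p)).toAddMonoidHom.compLeft ι
  have hf : Function.Surjective f :=
    (ZMod.castHom_surjective (dvd_pow_self p hν)).comp_left
  have h := f.ker.card_mul_index
  rw [AddSubgroup.index_ker, AddMonoidHom.range_eq_top.mpr hf, AddSubgroup.card_top] at h
  simp only [Nat.card_pi, Nat.card_zmod, Finset.prod_const, Finset.card_univ] at h
  have hker : Nat.card f.ker = p ^ ((ν - 1) * Fintype.card ι) := by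
    refine Nat.eq_of_mul_eq_mul_right (pow_pos hp.pos (Fintype.card ι)) ?_
    rw [h, ← pow_mul, ← pow_add]
    congr 1
    obtain ⟨n, rfl⟩ := Nat.exists_eq_succ_of_ne_zero hν
    simp
    ring
  rw [← hker]
  exact natCard_subtype_comp_of_surjective f hf A

theorem pow_mul_natCard_dotProduct_mulVec {p ν : ℕ} [Fact p.Prime] (hp2 : p ≠ 2) (hν : ν ≠ 0)
    {ι : Type*} [Fintype ι] (M : Matrix ι ι ℤ) {c : ℤ} (hc : ¬ (p : ℤ) ∣ c) :
    Nat.card {x : ι → ZMod (p ^ ν) // x ⬝ᵥ M.map (Int.cast : ℤ → ZMod (p ^ ν)) *ᵥ x = c}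
        * p ^ (ν - 1)
      = Nat.card {x : ι → ZMod p // x ⬝ᵥ M.map (Int.cast : ℤ → ZMod p) *ᵥ x = c}
        * p ^ ((ν - 1) * Fintype.card ι) := by
  have hp : p.Prime := Fact.out
  have := isLocalHom_castHom_prime_pow (p := p) hν
  set φ := ZMod.castHom (dvd_pow_self p hν) (ZMod p) with hφ
  have hcard := natCard_ker_unitsMap_castHom (p := p) hν
  rw [← hφ] at hcard
  have hc' : IsUnit (c : ZMod (p ^ ν)) := by
    refine isUnit_of_map_unit φ _ ?_
    rw [map_intCast]
    exact IsUnit.mk0 _ (mt (ZMod.intCast_zmod_eq_zero_iff_dvd c p).mp hc)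
  obtain ⟨u, hu⟩ := hc'
  have hG : (Nat.card (Units.map (φ : ZMod (p ^ ν) →* ZMod p)).ker).Coprime 2 := by
    rw [hcard]
    exact Nat.Coprime.pow_left _ ((Nat.coprime_primes hp Nat.prime_two).mpr hp2)
  have h := natCard_mul_natCard_ker_unitsMap φ hG (M.map (Int.cast : ℤ → ZMod (p ^ ν))) u
  rw [hcard, hu] at h
  rw [h, ← natCard_comp_castHom hν]
  refine Nat.card_congr (Equiv.subtypeEquivRight fun x => ?_)
  have hmap : M.map (Int.cast : ℤ → ZMod p) = (M.map (Int.cast : ℤ → ZMod (p ^ ν))).map φ := by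
    ext i j
    simp
  rw [map_intCast, RingHom.map_dotProduct, hmap]
  have : (φ ∘ (M.map (Int.cast : ℤ → ZMod (p ^ ν)) *ᵥ x))
      = (M.map (Int.cast : ℤ → ZMod (p ^ ν))).map φ *ᵥ (φ ∘ x) := by
    ext i
    exact RingHom.map_mulVec φ _ x i
  rw [this]
  rfl

/-- Let `p` be an odd prime, `e ≥ 1` odd, `S` a symmetric `e×e` integer matrix with even
diagonal, and `m', t` integers with `p ∤ det S`, `p ∤ m'`, `p ∤ t`. Then for every `ν ≥ 1`,
the number of `(v,λ) ∈ (ℤ/p^νℤ)^e × (ℤ/p^νℤ)` with `vᵀSv + 2m'λ² + 2t ≡ 0 (mod p^ν)`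
equals `p^{νe} − ε·p^{νe − (e+1)/2}`, with `ε` the Legendre symbol of
`(−1)^{(e+1)/2}·2·m'·det S` mod `p`. -/
theorem count_solutions_odd_rank (p : ℕ) [Fact p.Prime] (hp2 : p ≠ 2)
    (e : ℕ) (he : 1 ≤ e) (hodd : Odd e)
    (S : Matrix (Fin e) (Fin e) ℤ) (hsym : S.IsSymm) (hdiag : ∀ i, Even (S i i))
    (m' t : ℤ) (hdet : ¬ (p : ℤ) ∣ S.det) (hm : ¬ (p : ℤ) ∣ m') (ht : ¬ (p : ℤ) ∣ t)
    (ν : ℕ) (hν : 1 ≤ ν) :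
    (Nat.card {x : (Fin e → ZMod (p ^ ν)) × ZMod (p ^ ν) //
        x.1 ⬝ᵥ (S.map (Int.cast : ℤ → ZMod (p ^ ν))).mulVec x.1
          + 2 * (m' : ZMod (p ^ ν)) * x.2 ^ 2 + 2 * (t : ZMod (p ^ ν)) = 0} : ℤ) =
      (p : ℤ) ^ (ν * e) -
        legendreSym p ((-1) ^ ((e + 1) / 2) * 2 * m' * S.det) * (p : ℤ) ^ (ν * e - (e + 1) / 2) := by
  have hp : p.Prime := Fact.out
  have hν0 : ν ≠ 0 := by omega
  obtain ⟨k, hk⟩ : ∃ k, e + 1 = 2 * k := even_iff_two_dvd.mp hodd.add_one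
  have hk2 : (e + 1) / 2 = k := by omega
  have hp2' : ¬ (p : ℤ) ∣ 2 := fun h =>
    hp2 ((Nat.prime_dvd_prime_iff_eq hp Nat.prime_two).mp (by exact_mod_cast h))
  have hpZ : Prime (p : ℤ) := Nat.prime_iff_prime_int.mp hp
  let M : Matrix (Fin e ⊕ Unit) (Fin e ⊕ Unit) ℤ :=
    Matrix.fromBlocks S 0 0 (Matrix.of fun _ _ => 2 * m')
  have hMdet : M.det = S.det * (2 * m') := by simp [M]
  have hMdet' : ((M.map (Int.cast : ℤ → ZMod p)).det) = ((S.det * (2 * m') : ℤ) : ZMod p) := by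
    rw [← hMdet]
    exact ((Int.castRingHom (ZMod p)).map_det M).symm
  have hMsymm : (M.map (Int.cast : ℤ → ZMod p)).IsSymm := by
    refine Matrix.IsSymm.map ?_ _
    exact Matrix.IsSymm.fromBlocks hsym (by simp) (by ext; simp)
  have hι : Fintype.card (Fin e ⊕ Unit) = 2 * k := by simp [hk]
  have hc : ¬ (p : ℤ) ∣ -(2 * t) := by
    rw [dvd_neg, hpZ.dvd_mul]
    tauto
  have hne : (M.map (Int.cast : ℤ → ZMod p)).det ≠ 0 := by
    rw [hMdet', Ne, ZMod.intCast_zmod_eq_zero_iff_dvd, hpZ.dvd_mul, hpZ.dvd_mul]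
    tauto
  have hfield := card_mul_fiberCard_dotProduct_mulVec (by rwa [ZMod.ringChar_zmod_n]) hι hMsymm hne
    ((-(2 * t) : ℤ) : ZMod p)
  rw [fiberCard_eq_natCard, ZMod.card, if_neg (mt (ZMod.intCast_zmod_eq_zero_iff_dvd _ p).mp hc)]
    at hfield
  have hε : quadraticChar (ZMod p) ((-1) ^ k * (M.map (Int.cast : ℤ → ZMod p)).det)
      = legendreSym p ((-1) ^ ((e + 1) / 2) * 2 * m' * S.det) := by
    rw [legendreSym, hMdet', hk2]
    congr 1
    push_cast
    ring
  rw [hε] at hfield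
  have hlift := pow_mul_natCard_dotProduct_mulVec hp2 hν0 M hc
  have hsolutions : Nat.card {x : (Fin e → ZMod (p ^ ν)) × ZMod (p ^ ν) //
        x.1 ⬝ᵥ (S.map (Int.cast : ℤ → ZMod (p ^ ν))).mulVec x.1
          + 2 * (m' : ZMod (p ^ ν)) * x.2 ^ 2 + 2 * (t : ZMod (p ^ ν)) = 0}
      = Nat.card {x : Fin e ⊕ Unit → ZMod (p ^ ν) //
        x ⬝ᵥ M.map (Int.cast : ℤ → ZMod (p ^ ν)) *ᵥ x = ((-(2 * t) : ℤ) : ZMod (p ^ ν))} := by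
    refine Nat.card_congr (Equiv.subtypeEquiv (((Equiv.refl _).prodCongr
      (Equiv.funUnique Unit _).symm).trans (Equiv.sumArrowEquivProdArrow _ _ _).symm) ?_)
    rintro ⟨v, l⟩
    have hval : Sum.elim v (fun _ : Unit => l) ⬝ᵥ
        M.map (Int.cast : ℤ → ZMod (p ^ ν)) *ᵥ Sum.elim v (fun _ : Unit => l)
        = v ⬝ᵥ (S.map (Int.cast : ℤ → ZMod (p ^ ν))) *ᵥ v + 2 * (m' : ZMod (p ^ ν)) * l ^ 2 := by
      simp [M, Matrix.mulVec, dotProduct]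
      ring
    change _ ↔ Sum.elim v (fun _ : Unit => l) ⬝ᵥ
        M.map (Int.cast : ℤ → ZMod (p ^ ν)) *ᵥ Sum.elim v (fun _ : Unit => l) = _
    rw [hval]
    push_cast
    rw [eq_neg_iff_add_eq_zero]
  rw [hsolutions, hk2]
  rw [hk2] at hfield
  have hliftZ := congrArg (Nat.cast : ℕ → ℤ) hlift
  simp only [Nat.cast_mul, Nat.cast_pow, hι] at hliftZ
  obtain ⟨n, rfl⟩ := Nat.exists_eq_succ_of_ne_zero hν0
  obtain ⟨j, rfl⟩ : ∃ j, k = j + 1 := ⟨k - 1, by omega⟩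
  obtain rfl : e = 2 * j + 1 := by omega
  have hsub : (n + 1) * (2 * j + 1) - (j + 1) = n * (2 * j + 1) + j := by
    rw [add_mul]
    omega
  simp only [Nat.succ_eq_add_one, Nat.add_sub_cancel] at hliftZ ⊢
  rw [hsub]
  refine mul_right_cancel₀ (pow_ne_zero n hpZ.ne_zero) (mul_left_cancel₀ hpZ.ne_zero ?_)
  rw [hliftZ, ← mul_assoc, hfield]
  ring
end

section
/- Let p be an odd prime, let e ≥ 1 be an odd integer, let S be a symmetric e×e integer matrix with even diagonal entries, and let m' be an integer such that p ∤ det S and p ∤ m'. For ν ≥ 0 put N_ν = #{(v,λ) ∈ (ℤ/p^νℤ)^e × (ℤ/p^νℤ) : vᵀSv + 2m'λ² ≡ 0 (mod p^ν)} (so N_0 = 1). Then for every real s > e+1 the series Σ_{ν=0}^∞ N_ν p^{−νs} converges absolutely and equals (1 − ε·p^{(e−1)/2 − s}) / ((1 − p^{e−s})·(1 − ε·p^{(e+1)/2 − s})), where ε is the Legendre symbol of (−1)^{(e+1)/2}·2·m'·det S modulo p. -/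
open Matrix

/-- `N_ν`: the number of `(v,λ) ∈ (ℤ/p^νℤ)^e × (ℤ/p^νℤ)` with
`vᵀSv + 2m'λ² ≡ 0 (mod p^ν)`. -/
noncomputable def localCount (p e : ℕ) (S : Matrix (Fin e) (Fin e) ℤ) (m' : ℤ)
    (ν : ℕ) : ℕ :=
  Nat.card {x : (Fin e → ZMod (p ^ ν)) × ZMod (p ^ ν) //
    x.1 ⬝ᵥ (S.map (Int.cast : ℤ → ZMod (p ^ ν))).mulVec x.1
      + 2 * (m' : ZMod (p ^ ν)) * x.2 ^ 2 = 0}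

theorem Matrix.IsSymm.exists_diagonalization {K ι : Type*} [Field K] [Fintype ι] [DecidableEq ι]
    (h2 : (2 : K) ≠ 0) {M : Matrix ι ι K} (hM : M.IsSymm) :
    ∃ (P : Matrix ι ι K) (d : ι → K), IsUnit P.det ∧ Pᵀ * M * P = diagonal d := by
  have : Invertible (2 : K) := invertibleOfNonzero h2
  have hB : LinearMap.IsSymm (Matrix.toBilin' M) := by
    refine ⟨fun x y => ?_⟩
    simp only [Matrix.toBilin'_apply', RingHom.id_apply]
    rw [dotProduct_mulVec, ← mulVec_transpose, hM.eq, dotProduct_comm]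
  obtain ⟨v, hv⟩ := LinearMap.BilinForm.exists_orthogonal_basis hB
  let w : Module.Basis ι K (ι → K) := v.reindex (Fintype.equivOfCardEq (by simp))
  have hw : ∀ i j, i ≠ j → w i ⬝ᵥ M *ᵥ w j = 0 := by
    intro i j hij
    have := hv (i := (Fintype.equivOfCardEq (by simp) : Fin _ ≃ ι).symm i)
      (j := (Fintype.equivOfCardEq (by simp) : Fin _ ≃ ι).symm j) (by simpa using hij)
    simpa [w, Function.onFun, Matrix.toBilin'_apply'] using this
  refine ⟨(Pi.basisFun K ι).toMatrix w, fun i => w i ⬝ᵥ M *ᵥ w i, ?_, ?_⟩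
  · have := (Pi.basisFun K ι).invertibleToMatrix w
    exact Matrix.isUnit_det_of_invertible _
  · ext i j
    have : (((Pi.basisFun K ι).toMatrix w)ᵀ * M * (Pi.basisFun K ι).toMatrix w) i j
        = w i ⬝ᵥ M *ᵥ w j := by
      rw [Matrix.mul_assoc, Matrix.mul_apply']
      congr 1
    rw [this, diagonal_apply]
    split_ifs with h
    · rw [h]
    · exact hw i j h

theorem Matrix.dotProduct_mulVec_mulVec_self {R ι : Type*} [CommRing R] [Fintype ι]
    (M P : Matrix ι ι R) (y : ι → R) :
    (P *ᵥ y) ⬝ᵥ M *ᵥ (P *ᵥ y) = y ⬝ᵥ (Pᵀ * M * P) *ᵥ y := by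
  simp only [← mulVec_mulVec]
  rw [dotProduct_mulVec y, vecMul_transpose]

section
variable {F : Type*} [Field F] [Fintype F] [DecidableEq F]

theorem sum_addChar_mul_sq (hF : ringChar F ≠ 2) {ψ : AddChar F ℂ} (hψ : ψ.IsPrimitive)
    {a : F} (ha : a ≠ 0) :
    ∑ x : F, ψ (a * x ^ 2) =
      (quadraticChar F a : ℂ) * gaussSum ((quadraticChar F).ringHomComp (Int.castRingHom ℂ)) ψ := by
  have h1 : ∑ x : F, ψ (a * x ^ 2) = ∑ y : F, ((quadraticChar F y : ℂ) + 1) * ψ (a * y) := by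
    rw [← Finset.sum_fiberwise_of_maps_to (s := Finset.univ) (t := Finset.univ)
      (g := fun x : F => x ^ 2) (fun _ _ => Finset.mem_univ _)]
    refine Finset.sum_congr rfl fun y _ => ?_
    rw [Finset.sum_congr rfl (g := fun _ => ψ (a * y))
      (by intro x hx; rw [(Finset.mem_filter.1 hx).2]), Finset.sum_const, nsmul_eq_mul]
    congr 1
    have := quadraticChar_card_sqrts hF y
    rw [← Int.cast_one, ← Int.cast_add, ← this, Int.cast_natCast]
    congr 2
    ext; simp
  have h2 : ∑ y : F, ψ (a * y) = 0 := by
    have := AddChar.sum_mulShift a hψ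
    simpa [mul_comm, ha] using this
  simp only [h1, add_mul, one_mul, Finset.sum_add_distrib, h2, add_zero]
  have h3 := gaussSum_mulShift ((quadraticChar F).ringHomComp (Int.castRingHom ℂ)) ψ (Units.mk0 a ha)
  have h4 : (quadraticChar F a : ℂ) * quadraticChar F a = 1 := by
    rw [← Int.cast_mul, ← sq, quadraticChar_sq_one ha, Int.cast_one]
  rw [← h3]
  simp only [MulChar.ringHomComp_apply, Units.val_mk0, eq_intCast, ← mul_assoc, h4, one_mul]
  simp [gaussSum, AddChar.mulShift_apply]

theorem card_zeros_diagonal_mul_card {ι : Type*} [Fintype ι] [DecidableEq ι] (hF : ringChar F ≠ 2)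
    {ψ : AddChar F ℂ} (hψ : ψ.IsPrimitive)
    {k : ℕ} (hk : Fintype.card ι = 2 * k) (d : ι → F) (hd : ∏ i, d i ≠ 0) :
    (Fintype.card {x : ι → F // ∑ i, d i * x i ^ 2 = 0} : ℂ) * Fintype.card F =
      (Fintype.card F : ℂ) ^ (2 * k) + (Fintype.card F - 1) *
        ((quadraticChar F ((-1) ^ k * ∏ i, d i) : ℂ) * (Fintype.card F : ℂ) ^ k) := by
  have h1 : ∀ x : ι → F, ∑ t : F, ψ (t * ∑ i, d i * x i ^ 2) =
      if ∑ i, d i * x i ^ 2 = 0 then (Fintype.card F : ℂ) else 0 := by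
    intro x
    rw [AddChar.sum_mulShift _ hψ]
    split_ifs <;> simp
  have hsum : ∀ g : ι → F, ψ (∑ i, g i) = ∏ i, ψ (g i) := fun g =>
    map_prod ψ.toMonoidHom (fun i => Multiplicative.ofAdd (g i)) _
  have h2 : (Fintype.card {x : ι → F // ∑ i, d i * x i ^ 2 = 0} : ℂ) * Fintype.card F =
      ∑ t : F, ∏ i, ∑ x : F, ψ (t * d i * x ^ 2) := by
    simp_rw [Finset.prod_univ_sum, Fintype.piFinset_univ]
    rw [Finset.sum_comm, Fintype.card_subtype, Finset.card_filter, Nat.cast_sum, Finset.sum_mul]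
    refine Finset.sum_congr rfl fun x _ => ?_
    simp_rw [← hsum, mul_assoc, ← Finset.mul_sum]
    rw [h1]
    split_ifs <;> simp
  rw [h2, ← Finset.add_sum_erase _ _ (Finset.mem_univ (0 : F))]
  congr 1
  · simp [hk]
  · rw [Finset.sum_congr rfl (g := fun _ =>
      (quadraticChar F ((-1) ^ k * ∏ i, d i) : ℂ) * (Fintype.card F : ℂ) ^ k)]
    · rw [Finset.sum_const, Finset.card_erase_of_mem (Finset.mem_univ _), Finset.card_univ,
        nsmul_eq_mul, Nat.cast_sub Fintype.card_pos, Nat.cast_one]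
    · intro t ht
      have ht : t ≠ 0 := by simpa using ht
      have hdi : ∀ i, d i ≠ 0 := fun i => Finset.prod_ne_zero_iff.1 hd i (Finset.mem_univ _)
      rw [Finset.prod_congr rfl fun i _ => sum_addChar_mul_sq hF hψ (mul_ne_zero ht (hdi i))]
      have hq : ((quadraticChar F).ringHomComp (Int.castRingHom ℂ)).IsQuadratic :=
        (quadraticChar_isQuadratic F).comp _
      have hne : (quadraticChar F).ringHomComp (Int.castRingHom ℂ) ≠ 1 :=
        (MulChar.ringHomComp_ne_one_iff (RingHom.injective_int _)).2 (quadraticChar_ne_one hF)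
      simp only [Finset.prod_mul_distrib, map_mul, Int.cast_mul, Finset.prod_const,
        Finset.card_univ, hk, pow_mul, gaussSum_sq hne hq hψ, map_prod, map_pow,
        Int.cast_prod, Int.cast_pow]
      have h4 : (quadraticChar F t : ℂ) ^ 2 = 1 := by
        rw [← Int.cast_pow, quadraticChar_sq_one ht, Int.cast_one]
      rw [h4, mul_pow]
      simp
      ring

theorem card_zeros_symm_mul_card {ι : Type*} [Fintype ι] [DecidableEq ι] (hF : ringChar F ≠ 2)
    {ψ : AddChar F ℂ} (hψ : ψ.IsPrimitive)
    {k : ℕ} (hk : Fintype.card ι = 2 * k) {M : Matrix ι ι F} (hM : M.IsSymm) (hd : M.det ≠ 0) :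
    (Fintype.card {x : ι → F // x ⬝ᵥ M *ᵥ x = 0} : ℂ) * Fintype.card F =
      (Fintype.card F : ℂ) ^ (2 * k) + (Fintype.card F - 1) *
        ((quadraticChar F ((-1) ^ k * M.det) : ℂ) * (Fintype.card F : ℂ) ^ k) := by
  obtain ⟨P, d, hP, hPd⟩ := hM.exists_diagonalization (Ring.two_ne_zero hF)
  have hdet : ∏ i, d i = P.det ^ 2 * M.det := by
    rw [← det_diagonal, ← hPd, det_mul, det_mul, det_transpose]
    ring
  have h1 : Fintype.card {x : ι → F // x ⬝ᵥ M *ᵥ x = 0} =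
      Fintype.card {x : ι → F // ∑ i, d i * x i ^ 2 = 0} := by
    have hPi : IsUnit P := (Matrix.isUnit_iff_isUnit_det _).2 hP
    have hbij : Function.Bijective P.mulVec :=
      ⟨mulVec_injective_iff_isUnit.2 hPi, mulVec_surjective_iff_isUnit.2 hPi⟩
    refine (Fintype.card_congr (Equiv.subtypeEquiv (Equiv.ofBijective _ hbij) fun x => ?_)).symm
    rw [Equiv.ofBijective_apply, dotProduct_mulVec_mulVec_self, hPd]
    simp only [dotProduct, mulVec_diagonal]
    simp only [sq, mul_left_comm]
  rw [h1, card_zeros_diagonal_mul_card hF hψ hk d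
    (by rw [hdet]; exact mul_ne_zero (pow_ne_zero _ hP.ne_zero) hd), hdet,
    mul_left_comm ((-1 : F) ^ k), map_mul, map_pow, quadraticChar_sq_one hP.ne_zero, one_mul]
end

section
open Finset

theorem AddMonoidHom.card_subtype_comp {G H : Type*} [AddCommGroup G] [AddCommGroup H] [Finite G]
    [Finite H] (f : G →+ H) (P : H → Prop) :
    Nat.card {g // P (f g)} = Nat.card {g // f g = 0} * Nat.card {h // h ∈ f.range ∧ P h} := by
  classical
  have := Fintype.ofFinite G
  have := Fintype.ofFinite H
  simp only [Nat.card_eq_fintype_card, Fintype.card_subtype]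
  rw [card_eq_sum_card_fiberwise (f := f) (t := ({h | h ∈ f.range ∧ P h} : Finset H))
    (fun g hg => by simpa using hg), Finset.sum_congr rfl (g := fun _ => #{g | f g = 0}),
    sum_const, smul_eq_mul, mul_comm]
  intro h hh
  simp only [mem_filter, mem_univ, true_and, AddMonoidHom.mem_range] at hh
  rw [filter_filter, ← AddMonoidHom.card_fiber_eq_of_mem_range f (x := h) hh.1 ⟨0, map_zero f⟩]
  congr 1
  ext g
  simp only [mem_filter, mem_univ, true_and]
  exact ⟨fun hg => hg.2, fun hg => ⟨hg ▸ hh.2, hg⟩⟩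

theorem AddMonoidHom.card_subtype_comp_of_surjective {G H : Type*} [AddCommGroup G]
    [AddCommGroup H] [Finite G] [Finite H] (f : G →+ H) (hf : Function.Surjective f)
    (P : H → Prop) :
    Nat.card {g // P (f g)} * Nat.card H = Nat.card G * Nat.card {h // P h} := by
  have h1 := f.card_subtype_comp P
  have h2 := f.card_subtype_comp fun _ => True
  have hr : ∀ h, h ∈ f.range := hf
  simp only [hr, true_and, Nat.card_congr (Equiv.subtypeUnivEquiv fun _ => trivial)] at h1 h2
  rw [h1, h2]; ring

theorem AddMonoidHom.card_ker_mul_card_of_surjective {G H : Type*} [AddCommGroup G]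
    [AddCommGroup H] [Finite G] [Finite H] (f : G →+ H) (hf : Function.Surjective f) :
    Nat.card {g // f g = 0} * Nat.card H = Nat.card G := by
  rw [f.card_subtype_comp_of_surjective hf fun h => h = 0,
    Nat.card_unique (α := {h : H // h = 0}), mul_one]

theorem sum_card_subtype_comm {α β : Type*} [Fintype α] [Fintype β] (r : α → β → Prop) :
    ∑ a, Nat.card {b // r a b} = ∑ b, Nat.card {a // r a b} := by
  classical
  simp only [Nat.card_eq_fintype_card, Fintype.card_subtype, card_filter]
  exact sum_comm

theorem Nat.card_subtype_and_not {α : Type*} [Finite α] (P Q : α → Prop) :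
    Nat.card {a // P a} = Nat.card {a // Q a ∧ P a} + Nat.card {a // ¬ Q a ∧ P a} := by
  classical
  have := Fintype.ofFinite α
  simp only [Nat.card_eq_fintype_card, Fintype.card_subtype]
  rw [← card_filter_add_card_filter_not (s := ({a | P a} : Finset α)) Q]
  simp only [filter_filter, and_comm]
end

section
variable {p : ℕ}

theorem ZMod.pow_mul_eq_zero_iff [NeZero p] {a b c : ℕ} (h : a + b = c) (x : ZMod (p ^ c)) :
    (p : ZMod (p ^ c)) ^ a * x = 0 ↔
      ZMod.castHom (pow_dvd_pow p (h ▸ Nat.le_add_left b a)) (ZMod (p ^ b)) x = 0 := by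
  obtain ⟨n, rfl⟩ := ZMod.natCast_zmod_surjective x
  rw [map_natCast, ZMod.natCast_eq_zero_iff, ← Nat.cast_pow, ← Nat.cast_mul,
    ZMod.natCast_eq_zero_iff, ← h, pow_add,
    Nat.mul_dvd_mul_iff_left (pow_pos (NeZero.pos p) a)]

theorem ZMod.castHom_pow_eq_zero_iff [NeZero p] {a c : ℕ} (h : a ≤ c) (x : ZMod (p ^ c)) :
    ZMod.castHom (pow_dvd_pow p h) (ZMod (p ^ a)) x = 0 ↔
      ∃ y, (p : ZMod (p ^ c)) ^ a * y = x := by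
  constructor
  · obtain ⟨n, rfl⟩ := ZMod.natCast_zmod_surjective x
    rw [map_natCast, ZMod.natCast_eq_zero_iff]
    rintro ⟨m, rfl⟩
    exact ⟨m, by simp⟩
  · rintro ⟨y, rfl⟩
    rw [map_mul, map_pow, map_natCast, ← Nat.cast_pow, ZMod.natCast_self, zero_mul]

theorem ZMod.isUnit_natCast_pow_iff [Fact p.Prime] {a : ℕ} (ha : a ≠ 0) (n : ℕ) :
    IsUnit (n : ZMod (p ^ a)) ↔ ¬ p ∣ n := by
  rw [ZMod.isUnit_iff_coprime, Nat.coprime_pow_right_iff (Nat.pos_of_ne_zero ha),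
    Nat.coprime_comm, (Fact.out : p.Prime).coprime_iff_not_dvd]

theorem ZMod.isUnit_intCast_pow_iff [Fact p.Prime] {a : ℕ} (ha : a ≠ 0) (n : ℤ) :
    IsUnit (n : ZMod (p ^ a)) ↔ ¬ (p : ℤ) ∣ n := by
  have := ZMod.isUnit_natCast_pow_iff (p := p) ha n.natAbs
  rw [Int.natCast_dvd, ← this]
  rcases Int.natAbs_eq n with h | h
  · conv_lhs => rw [h]
    simp
  · conv_lhs => rw [h]
    simp

theorem ZMod.isUnit_castHom_pow_iff [Fact p.Prime] {a b : ℕ} (ha : a ≠ 0) (h : a ≤ b)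
    (x : ZMod (p ^ b)) :
    IsUnit (ZMod.castHom (pow_dvd_pow p h) (ZMod (p ^ a)) x) ↔ IsUnit x := by
  obtain ⟨n, rfl⟩ := ZMod.natCast_zmod_surjective x
  rw [map_natCast, ZMod.isUnit_natCast_pow_iff ha, ZMod.isUnit_natCast_pow_iff (by omega)]

theorem ZMod.not_isUnit_pow_iff [Fact p.Prime] {a : ℕ} (ha : a ≠ 0) (x : ZMod (p ^ a)) :
    ¬ IsUnit x ↔ ∃ y, (p : ZMod (p ^ a)) * y = x := by
  have h := ZMod.castHom_pow_eq_zero_iff (p := p) (Nat.one_le_iff_ne_zero.2 ha) x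
  simp only [pow_one (p : ZMod (p ^ a))] at h
  rw [← h]
  obtain ⟨n, rfl⟩ := ZMod.natCast_zmod_surjective x
  rw [ZMod.isUnit_natCast_pow_iff ha, not_not, map_natCast, ZMod.natCast_eq_zero_iff, pow_one]
end

section
variable {ι : Type*} [Fintype ι]

/-- The value at `x` of the quadratic form with integral Gram matrix `M`, in a ring `R`. -/
def Matrix.intQuadForm (M : Matrix ι ι ℤ) {R : Type*} [CommRing R] (x : ι → R) : R :=
  x ⬝ᵥ (M.map (Int.cast : ℤ → R)) *ᵥ x

theorem Matrix.intQuadForm_map (M : Matrix ι ι ℤ) {R R' : Type*} [CommRing R] [CommRing R']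
    (f : R →+* R') (x : ι → R) : M.intQuadForm (f ∘ x) = f (M.intQuadForm x) := by
  simp only [intQuadForm, dotProduct, mulVec, map_sum, map_mul, Matrix.map_apply, map_intCast,
    Function.comp_apply]

theorem Matrix.intQuadForm_mul (M : Matrix ι ι ℤ) {R : Type*} [CommRing R] (c : R) (x : ι → R) :
    M.intQuadForm (fun i => c * x i) = c ^ 2 * M.intQuadForm x := by
  have : (fun i => c * x i) = c • x := rfl
  rw [intQuadForm, this, mulVec_smul, smul_dotProduct, dotProduct_smul, intQuadForm, smul_eq_mul,
    smul_eq_mul]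
  ring

theorem Matrix.intQuadForm_add (M : Matrix ι ι ℤ) (hM : M.IsSymm) {R : Type*} [CommRing R]
    (x y : ι → R) :
    M.intQuadForm (x + y) = M.intQuadForm x +
      2 * ((M.map (Int.cast : ℤ → R)) *ᵥ x) ⬝ᵥ y + M.intQuadForm y := by
  have h1 : x ⬝ᵥ (M.map (Int.cast : ℤ → R)) *ᵥ y = ((M.map (Int.cast : ℤ → R)) *ᵥ x) ⬝ᵥ y := by
    rw [dotProduct_mulVec, ← mulVec_transpose, ← transpose_map, hM.eq]
  simp only [intQuadForm, mulVec_add, add_dotProduct, dotProduct_add, h1]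
  rw [dotProduct_comm y]
  ring

variable {p : ℕ}

/-- Coordinatewise reduction from level `p ^ b` to level `p ^ a`. -/
def ZMod.piReduce (p : ℕ) (ι : Type*) {a b : ℕ} (h : a ≤ b) :
    (ι → ZMod (p ^ b)) →+ (ι → ZMod (p ^ a)) :=
  (ZMod.castHom (pow_dvd_pow p h) (ZMod (p ^ a))).toAddMonoidHom.compLeft ι

theorem ZMod.piReduce_eq_comp {ι : Type*} {a b : ℕ} (h : a ≤ b) (x : ι → ZMod (p ^ b)) :
    ZMod.piReduce p ι h x = ZMod.castHom (pow_dvd_pow p h) (ZMod (p ^ a)) ∘ x := rfl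

theorem ZMod.piReduce_surjective {ι : Type*} {a b : ℕ} (h : a ≤ b) :
    Function.Surjective (ZMod.piReduce p ι h) :=
  (ZMod.castHom_surjective (pow_dvd_pow p h)).comp_left

/-- The number of zeros modulo `p ^ a` of an integral quadratic form. -/
noncomputable def Matrix.zeroCount (M : Matrix ι ι ℤ) (p a : ℕ) : ℕ :=
  Nat.card {x : ι → ZMod (p ^ a) // M.intQuadForm x = 0}

/-- The number of zeros modulo `p ^ a` with at least one unit coordinate. -/
noncomputable def Matrix.primitiveZeroCount (M : Matrix ι ι ℤ) (p a : ℕ) : ℕ :=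
  Nat.card {x : ι → ZMod (p ^ a) // (∃ i, IsUnit (x i)) ∧ M.intQuadForm x = 0}

theorem Matrix.zeroCount_add_two [Fact p.Prime] (M : Matrix ι ι ℤ) (a : ℕ) :
    M.zeroCount p (a + 2) =
      M.primitiveZeroCount p (a + 2) + p ^ Fintype.card ι * M.zeroCount p a := by
  have hp : 0 < p := (Fact.out : p.Prime).pos
  rw [zeroCount, Nat.card_subtype_and_not _ fun x => ∃ i, IsUnit (x i), ← primitiveZeroCount]
  congr 1
  let f : (ι → ZMod (p ^ (a + 2))) →+ (ι → ZMod (p ^ (a + 2))) :=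
    (AddMonoidHom.mulLeft (p : ZMod (p ^ (a + 2)))).compLeft ι
  have hf : ∀ x, f x = fun i => (p : ZMod (p ^ (a + 2))) * x i := fun x => rfl
  have hrange : ∀ x, x ∈ f.range ↔ ¬ ∃ i, IsUnit (x i) := by
    intro x
    simp only [not_exists, ZMod.not_isUnit_pow_iff (p := p) (a := a + 2) (by omega)]
    constructor
    · rintro ⟨y, rfl⟩ i
      exact ⟨y i, rfl⟩
    · intro h
      choose y hy using h
      exact ⟨y, funext hy⟩
  have h1 := f.card_subtype_comp fun x => M.intQuadForm x = 0
  have hker : ∀ x, f x = 0 ↔ ZMod.piReduce p ι (show a + 1 ≤ a + 2 by omega) x = 0 := by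
    intro x
    simp only [funext_iff, hf, ZMod.piReduce_eq_comp, Function.comp_apply, Pi.zero_apply]
    refine forall_congr' fun i => ?_
    rw [← ZMod.pow_mul_eq_zero_iff (a := 1) (by omega), pow_one]
  have h2 := (ZMod.piReduce p ι (Nat.le_add_right a 2)).card_subtype_comp_of_surjective
    (ZMod.piReduce_surjective _) fun x => M.intQuadForm x = 0
  have h3 : ∀ x, M.intQuadForm (f x) = 0 ↔
      M.intQuadForm (ZMod.piReduce p ι (Nat.le_add_right a 2) x) = 0 := by
    intro x
    rw [hf, intQuadForm_mul, ZMod.piReduce_eq_comp, intQuadForm_map,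
      ← ZMod.pow_mul_eq_zero_iff (a := 2) (by omega)]
  have h4 := (ZMod.piReduce p ι (show a + 1 ≤ a + 2 by omega)).card_ker_mul_card_of_surjective
    (ZMod.piReduce_surjective _)
  simp only [h3, hker, hrange] at h1
  rw [h1, ← zeroCount] at h2
  simp only [Nat.card_fun, Nat.card_zmod, Nat.card_eq_fintype_card (α := ι)] at h2 h4
  have h5 : Nat.card {x // ZMod.piReduce p ι (show a + 1 ≤ a + 2 by omega) x = 0} =
      p ^ Fintype.card ι := by
    refine Nat.eq_of_mul_eq_mul_right (show 0 < (p ^ (a + 1)) ^ Fintype.card ι by positivity) ?_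
    rw [h4, ← mul_pow, ← pow_succ']
  rw [h5] at h2
  refine Nat.eq_of_mul_eq_mul_left (show 0 < p ^ Fintype.card ι * (p ^ a) ^ Fintype.card ι by
    positivity) ?_
  calc _ = _ := by ring
    _ = _ := h2
    _ = _ := by rw [pow_add, mul_pow]; ring

theorem Matrix.zeroCount_one [Fact p.Prime] (M : Matrix ι ι ℤ) :
    M.zeroCount p 1 = M.primitiveZeroCount p 1 + 1 := by
  rw [zeroCount, Nat.card_subtype_and_not _ fun x => ∃ i, IsUnit (x i), ← primitiveZeroCount]
  congr 1
  have h0 : (p : ZMod (p ^ 1)) = 0 := by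
    rw [ZMod.natCast_eq_zero_iff, pow_one]
  have h : ∀ x : ι → ZMod (p ^ 1),
      ((¬ ∃ i, IsUnit (x i)) ∧ M.intQuadForm x = 0) ↔ x = 0 := by
    intro x
    simp only [not_exists]
    constructor
    · rintro ⟨h, -⟩
      funext i
      obtain ⟨y, hy⟩ := (ZMod.not_isUnit_pow_iff one_ne_zero _).1 (h i)
      rw [← hy, h0, zero_mul, Pi.zero_apply]
    · rintro rfl
      refine ⟨fun i => ?_, by simp [intQuadForm]⟩
      exact (ZMod.not_isUnit_pow_iff one_ne_zero _).2 ⟨0, by simp⟩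
  simp only [h, Nat.card_unique]

theorem Matrix.zeroCount_zero (M : Matrix ι ι ℤ) : M.zeroCount p 0 = 1 := by
  have : Subsingleton (ZMod (p ^ 0)) := by rw [pow_zero]; infer_instance
  rw [zeroCount, Nat.card_congr (Equiv.subtypeUnivEquiv fun _ => Subsingleton.elim _ _),
    Nat.card_unique]

theorem Matrix.dotProduct_surjective_of_isUnit {R : Type*} [CommRing R] {w : ι → R} {i : ι}
    (hi : IsUnit (w i)) : Function.Surjective fun y : ι → R => w ⬝ᵥ y := by
  classical
  intro r
  obtain ⟨u, hu⟩ := hi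
  refine ⟨Pi.single i (↑u⁻¹ * r), ?_⟩
  simp [← hu]

theorem Matrix.exists_isUnit_mulVec [Fact p.Prime] [DecidableEq ι] {a : ℕ} (ha : a ≠ 0)
    {A : Matrix ι ι (ZMod (p ^ a))} (hA : IsUnit A.det) {x : ι → ZMod (p ^ a)}
    (hx : ∃ i, IsUnit (x i)) : ∃ i, IsUnit ((A *ᵥ x) i) := by
  by_contra! h
  simp only [ZMod.not_isUnit_pow_iff ha] at h
  choose y hy using h
  obtain ⟨i, hi⟩ := hx
  refine (ZMod.not_isUnit_pow_iff ha (x i)).2 ⟨(A⁻¹ *ᵥ y) i, ?_⟩ hi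
  have h1 : (p : ZMod (p ^ a)) • y = A *ᵥ x := funext hy
  have h2 : A⁻¹ *ᵥ ((p : ZMod (p ^ a)) • y) = x := by
    rw [h1, mulVec_mulVec, nonsing_inv_mul _ hA, one_mulVec]
  rw [mulVec_smul] at h2
  exact congrFun h2 i

theorem Matrix.primitiveZeroCount_succ_mul [Fact p.Prime] [DecidableEq ι] (hp2 : p ≠ 2)
    {M : Matrix ι ι ℤ} (hM : M.IsSymm) (hdet : ¬ (p : ℤ) ∣ M.det) {a : ℕ} (ha : a ≠ 0) :
    M.primitiveZeroCount p (a + 1) * p =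
      p ^ Fintype.card ι * M.primitiveZeroCount p a := by
  classical
  have hp : 0 < p := (Fact.out : p.Prime).pos
  let R := ZMod (p ^ (a + 1))
  let π : R := (p : R) ^ a
  have hπ : π ^ 2 = 0 := by
    rw [← pow_mul, ← Nat.cast_pow, ZMod.natCast_eq_zero_iff]
    exact pow_dvd_pow p (by omega)
  have hr := Nat.le_add_right a 1
  -- Reduction modulo `p ^ a` has fibres of equal size and preserves primitivity.
  have h1 := (ZMod.piReduce p ι hr).card_subtype_comp_of_surjective
    (ZMod.piReduce_surjective hr) fun x => (∃ i, IsUnit (x i)) ∧ M.intQuadForm x = 0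
  simp only [ZMod.piReduce_eq_comp, Function.comp_apply, ZMod.isUnit_castHom_pow_iff ha hr,
    intQuadForm_map] at h1
  have hprim : ∀ x y : ι → R, (∃ i, IsUnit ((x + fun j => π * y j) i)) ↔ ∃ i, IsUnit (x i) := by
    intro x y
    refine exists_congr fun i => ?_
    rw [← ZMod.isUnit_castHom_pow_iff ha hr, ← ZMod.isUnit_castHom_pow_iff ha hr (x i),
      Pi.add_apply, map_add, (ZMod.castHom_pow_eq_zero_iff hr (π * y i)).2 ⟨_, rfl⟩, add_zero]
  have hcol : ∀ y : ι → R, Nat.card {x : ι → R // (∃ i, IsUnit (x i)) ∧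
      M.intQuadForm (x + fun j => π * y j) = 0} = M.primitiveZeroCount p (a + 1) := by
    intro y
    refine Nat.card_congr (Equiv.subtypeEquiv (Equiv.addRight fun j => π * y j) fun x => ?_)
    simp only [Equiv.coe_addRight, hprim]
  have htwo : IsUnit (2 : R) := by
    have := (ZMod.isUnit_natCast_pow_iff (p := p) (a := a + 1) (by omega) 2).2
      (fun h => hp2 ((Nat.prime_dvd_prime_iff_eq Fact.out Nat.prime_two).1 h))
    exact_mod_cast this
  have hdu : IsUnit (M.map (Int.cast : ℤ → R)).det := by
    have := (ZMod.isUnit_intCast_pow_iff (p := p) (a := a + 1) (by omega) _).2 hdet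
    rwa [show (M.map (Int.cast : ℤ → R)) = (Int.castRingHom R).mapMatrix M from rfl,
      ← RingHom.map_det]
  have hscal : ∀ c : R, Nat.card {r : R // c + π * r = 0} =
      if ZMod.castHom (pow_dvd_pow p hr) (ZMod (p ^ a)) c = 0 then p ^ a else 0 := by
    intro c
    have h := (AddMonoidHom.mulLeft π).card_subtype_comp fun r => c + r = 0
    have hk := (ZMod.castHom (pow_dvd_pow p (Nat.le_add_left 1 a))
      (ZMod (p ^ 1))).toAddMonoidHom.card_ker_mul_card_of_surjective
        (ZMod.castHom_surjective (pow_dvd_pow p (Nat.le_add_left 1 a)))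
    have hker : ∀ x : R, π * x = 0 ↔ (ZMod.castHom (pow_dvd_pow p (Nat.le_add_left 1 a))
      (ZMod (p ^ 1))).toAddMonoidHom x = 0 := ZMod.pow_mul_eq_zero_iff rfl
    simp only [AddMonoidHom.coe_mulLeft, hker, Nat.card_zmod] at h hk
    rw [h, Nat.eq_of_mul_eq_mul_right (show 0 < p ^ 1 by positivity) (hk.trans (pow_add p a 1))]
    split_ifs with hc
    · obtain ⟨y, hy⟩ := (ZMod.castHom_pow_eq_zero_iff hr c).1 hc
      have : ∀ r : R, (r ∈ (AddMonoidHom.mulLeft π).range ∧ c + r = 0) ↔ r = -c := by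
        intro r
        rw [eq_neg_iff_add_eq_zero, add_comm r c, and_iff_right_iff_imp]
        intro h
        refine ⟨-y, ?_⟩
        rw [AddMonoidHom.coe_mulLeft, mul_neg, hy, neg_eq_iff_add_eq_zero, h]
      simp only [this, Nat.card_unique, mul_one]
    · have : IsEmpty {r : R // r ∈ (AddMonoidHom.mulLeft π).range ∧ c + r = 0} := by
        refine ⟨fun ⟨r, ⟨y, hy⟩, h⟩ => hc ?_⟩
        refine (ZMod.castHom_pow_eq_zero_iff hr c).2 ⟨-y, ?_⟩
        rw [AddMonoidHom.coe_mulLeft] at hy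
        rw [mul_neg, hy, neg_eq_iff_add_eq_zero, add_comm r c, h]
      rw [Nat.card_of_isEmpty, mul_zero]
  have hrow : ∀ x : ι → R, (∃ i, IsUnit (x i)) →
      Nat.card {y : ι → R // M.intQuadForm (x + fun j => π * y j) = 0} * p =
      if ZMod.castHom (pow_dvd_pow p hr) (ZMod (p ^ a)) (M.intQuadForm x) = 0 then
        Nat.card (ι → R) else 0 := by
    intro x hx
    obtain ⟨i, hi⟩ := exists_isUnit_mulVec (p := p) (by omega) hdu hx
    have hsurj := dotProduct_surjective_of_isUnit (w := (2 : R) • (M.map (Int.cast : ℤ → R)) *ᵥ x)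
      (i := i) (htwo.mul hi)
    let L : (ι → R) →+ R :=
      ⟨⟨fun y => ((2 : R) • (M.map (Int.cast : ℤ → R)) *ᵥ x) ⬝ᵥ y, by simp⟩,
        fun y z => by simp only [dotProduct_add]⟩
    have h := L.card_subtype_comp_of_surjective hsurj fun r => M.intQuadForm x + π * r = 0
    have hL : ∀ y, M.intQuadForm (x + fun j => π * y j) = M.intQuadForm x + π * L y := by
      intro y
      rw [intQuadForm_add _ hM, intQuadForm_mul, hπ, zero_mul, add_zero]
      congr 1
      change _ = π * (((2 : R) • (M.map (Int.cast : ℤ → R)) *ᵥ x) ⬝ᵥ y)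
      rw [show (fun j => π * y j) = π • y from rfl, dotProduct_smul, smul_dotProduct,
        smul_eq_mul, smul_eq_mul]
      ring
    simp only [hL]
    rw [hscal, Nat.card_zmod] at h
    refine Nat.eq_of_mul_eq_mul_left (show 0 < p ^ a by positivity) ?_
    rw [mul_left_comm, ← pow_succ, h]
    split_ifs <;> simp [mul_comm]
  have hdc := sum_card_subtype_comm fun (y x : ι → R) =>
    (∃ i, IsUnit (x i)) ∧ M.intQuadForm (x + fun j => π * y j) = 0
  have hrow' : ∀ x : ι → R, Nat.card {y : ι → R //
      (∃ i, IsUnit (x i)) ∧ M.intQuadForm (x + fun j => π * y j) = 0} * p =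
      if (∃ i, IsUnit (x i)) ∧
        ZMod.castHom (pow_dvd_pow p hr) (ZMod (p ^ a)) (M.intQuadForm x) = 0 then
        Nat.card (ι → R) else 0 := by
    intro x
    by_cases hx : ∃ i, IsUnit (x i)
    · simp only [hx, true_and]
      exact hrow x hx
    · simp [hx]
  simp only [hcol] at hdc
  rw [Finset.sum_const, Finset.card_univ, smul_eq_mul, ← Nat.card_eq_fintype_card] at hdc
  have hG : 0 < Nat.card (ι → R) := Nat.card_pos
  have hX : M.primitiveZeroCount p (a + 1) * p = Nat.card {x : ι → R // (∃ i, IsUnit (x i)) ∧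
      ZMod.castHom (pow_dvd_pow p hr) (ZMod (p ^ a)) (M.intQuadForm x) = 0} := by
    refine Nat.eq_of_mul_eq_mul_left hG ?_
    rw [← mul_assoc, hdc, Finset.sum_mul, Finset.sum_congr rfl fun x _ => hrow' x,
      Finset.sum_ite, Finset.sum_const_zero, add_zero, Finset.sum_const, smul_eq_mul, mul_comm,
      Nat.card_eq_fintype_card (α := Subtype _), Fintype.card_subtype]
  rw [hX]
  simp only [Nat.card_fun, Nat.card_zmod, Nat.card_eq_fintype_card (α := ι)] at h1
  refine Nat.eq_of_mul_eq_mul_right (show 0 < (p ^ a) ^ Fintype.card ι by positivity) ?_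
  rw [h1, primitiveZeroCount, pow_succ, mul_pow]
  ring
end

theorem tsum_of_two_step_recurrence {q T ε : ℝ} {j : ℕ} {N P : ℕ → ℝ} (hq : 1 < q) (hT : 0 < T)
    (hqT : q ^ (2 * j + 2) * T < 1) (hε : ε ^ 2 = 1) (hN0 : ∀ a, 0 ≤ N a)
    (hN : ∀ a, N a ≤ (q ^ a) ^ (2 * j + 2))
    (h0 : N 0 = 1) (h1 : N 1 = P 1 + 1)
    (hrec : ∀ a, N (a + 2) = P (a + 2) + q ^ (2 * j + 2) * N a)
    (hP : ∀ a, P (a + 2) * q = q ^ (2 * j + 2) * P (a + 1))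
    (hN1 : N 1 * q = q ^ (2 * j + 2) + (q - 1) * (ε * q ^ (j + 1))) :
    Summable (fun a => N a * T ^ a) ∧ ∑' a, N a * T ^ a =
      (1 - ε * (q ^ j * T)) / ((1 - q ^ (2 * j + 1) * T) * (1 - ε * (q ^ (j + 1) * T))) := by
  have hq0 : 0 < q := by linarith
  have hsum : Summable (fun a => N a * T ^ a) := by
    refine Summable.of_nonneg_of_le (fun a => mul_nonneg (hN0 a) (by positivity)) (fun a => ?_)
      (summable_geometric_of_lt_one (by positivity) hqT)
    calc N a * T ^ a ≤ (q ^ a) ^ (2 * j + 2) * T ^ a := by gcongr; exact hN a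
      _ = _ := by rw [mul_pow, ← pow_mul, ← pow_mul, mul_comm a]
  refine ⟨hsum, ?_⟩
  have hP' : ∀ a, P (a + 1) = (q ^ (2 * j + 1)) ^ a * P 1 := by
    intro a
    induction a with
    | zero => simp
    | succ a ih =>
      refine mul_right_cancel₀ hq0.ne' ?_
      rw [hP, ih]; ring
  have hr : q ^ (2 * j + 1) * T < 1 := lt_of_le_of_lt (by gcongr <;> linarith) hqT
  have hk : q ^ (j + 1) * T < 1 := lt_of_le_of_lt (by gcongr <;> linarith) hqT
  have hk0 : 0 < q ^ (j + 1) * T := by positivity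
  have hgeo : HasSum (fun a => P 1 * q ^ (2 * j + 1) * T ^ 2 * (q ^ (2 * j + 1) * T) ^ a)
      (P 1 * q ^ (2 * j + 1) * T ^ 2 * (1 - q ^ (2 * j + 1) * T)⁻¹) :=
    (hasSum_geometric_of_lt_one (by positivity) hr).mul_left _
  have hF := hsum.sum_add_tsum_nat_add 2
  have hshift : ∀ a, N (a + 2) * T ^ (a + 2) =
      P 1 * q ^ (2 * j + 1) * T ^ 2 * (q ^ (2 * j + 1) * T) ^ a +
        q ^ (2 * j + 2) * T ^ 2 * (N a * T ^ a) := by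
    intro a
    rw [hrec, hP' (a + 1)]
    ring
  simp only [hshift] at hF
  rw [hgeo.summable.tsum_add (hsum.mul_left _), tsum_mul_left (a := q ^ (2 * j + 2) * T ^ 2),
    hgeo.tsum_eq, Finset.sum_range_succ, Finset.sum_range_one, h0, pow_zero, pow_one, h1] at hF
  set F := ∑' a, N a * T ^ a
  have hP1 : P 1 = (q ^ (j + 1) - ε) * (q ^ j + ε) := by
    refine mul_right_cancel₀ hq0.ne' ?_
    rw [h1] at hN1
    linear_combination hN1 + q * hε
  have hε' : ε = 1 ∨ ε = -1 := mul_self_eq_one_iff.1 (by rwa [← sq])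
  have hd1 : 1 - q ^ (2 * j + 1) * T ≠ 0 := by linarith
  have hd2 : 1 - ε * (q ^ (j + 1) * T) ≠ 0 := by
    rcases hε' with rfl | rfl <;> nlinarith
  have hd3 : 1 + ε * (q ^ (j + 1) * T) ≠ 0 := by
    rcases hε' with rfl | rfl <;> nlinarith
  rw [eq_div_iff (mul_ne_zero hd1 hd2)]
  refine mul_right_cancel₀ hd3 ?_
  rw [hP1] at hF
  linear_combination -(1 - q ^ (2 * j + 1) * T) * hF
    + (q ^ (j + 1) - ε) * (q ^ j + ε) * q ^ (2 * j + 1) * T ^ 2 * mul_inv_cancel₀ hd1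
    + (q ^ (2 * j + 1) * T ^ 2 - T
      - F * (1 - q ^ (2 * j + 1) * T) * (q ^ (j + 1) * T) ^ 2) * hε

theorem Matrix.zeroCount_le {ι : Type*} [Fintype ι] {p : ℕ} [NeZero p] (M : Matrix ι ι ℤ) (a : ℕ) :
    M.zeroCount p a ≤ (p ^ a) ^ Fintype.card ι := by
  refine (Nat.card_le_card_of_injective _ Subtype.val_injective).trans_eq ?_
  rw [Nat.card_fun, Nat.card_zmod, Nat.card_eq_fintype_card]

theorem Matrix.zeroCount_one_mul {ι : Type*} [Fintype ι] [DecidableEq ι] {p : ℕ} [Fact p.Prime]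
    (hp2 : p ≠ 2) {k : ℕ} (hk : Fintype.card ι = 2 * k) {M : Matrix ι ι ℤ} (hM : M.IsSymm)
    (hdet : ¬ (p : ℤ) ∣ M.det) :
    (M.zeroCount p 1 : ℝ) * p =
      (p : ℝ) ^ (2 * k) + (p - 1) * (legendreSym p ((-1) ^ k * M.det) * (p : ℝ) ^ k) := by
  have hdet' : (M.map (Int.cast : ℤ → ZMod p)).det = (M.det : ZMod p) :=
    ((Int.castRingHom (ZMod p)).map_det M).symm
  have h := card_zeros_symm_mul_card (F := ZMod p) (by rwa [ZMod.ringChar_zmod_n])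
    (ZMod.isPrimitive_stdAddChar p) hk (M := M.map (Int.cast : ℤ → ZMod p))
    (by rw [IsSymm, ← transpose_map, hM.eq])
    (by rwa [hdet', Ne, ZMod.intCast_zmod_eq_zero_iff_dvd])
  have h1 : M.zeroCount p 1 =
      Fintype.card {x : ι → ZMod p // x ⬝ᵥ M.map (Int.cast : ℤ → ZMod p) *ᵥ x = 0} := by
    rw [zeroCount, pow_one, Nat.card_eq_fintype_card]
    rfl
  rw [hdet', ← h1, ZMod.card] at h
  rw [legendreSym]
  push_cast at h ⊢
  exact_mod_cast h

theorem localCount_eq_zeroCount (p e : ℕ) (S : Matrix (Fin e) (Fin e) ℤ) (m' : ℤ) (a : ℕ) :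
    localCount p e S m' a =
      (fromBlocks S 0 0 (of fun _ _ : Unit => 2 * m')).zeroCount p a := by
  refine Nat.card_congr (Equiv.subtypeEquiv
    (((Equiv.refl _).prodCongr (Equiv.funUnique Unit _).symm).trans
      (Equiv.sumArrowEquivProdArrow _ _ _).symm) fun x => ?_)
  have : intQuadForm (fromBlocks S 0 0 (of fun _ _ : Unit => 2 * m'))
      (Sum.elim x.1 fun _ => x.2) = x.1 ⬝ᵥ (S.map (Int.cast : ℤ → ZMod (p ^ a))).mulVec x.1
      + 2 * (m' : ZMod (p ^ a)) * x.2 ^ 2 := by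
    simp [intQuadForm, dotProduct, mulVec]
    ring
  rw [← this]
  rfl

/-- Let `p` be an odd prime, `e ≥ 1` odd, `S` symmetric with even diagonal, `p ∤ det S`,
`p ∤ m'`. For real `s > e+1` the series `Σ_ν N_ν p^{−νs}` converges absolutely and equals
`(1 − ε·p^{(e−1)/2 − s}) / ((1 − p^{e−s})·(1 − ε·p^{(e+1)/2 − s}))`, where `ε` is the
Legendre symbol of `(−1)^{(e+1)/2}·2·m'·det S` mod `p`. -/
theorem local_L_series_closed_form (p : ℕ) [Fact p.Prime] (hp2 : p ≠ 2)
    (e : ℕ) (he : 1 ≤ e) (hodd : Odd e)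
    (S : Matrix (Fin e) (Fin e) ℤ) (hsym : S.IsSymm) (hdiag : ∀ i, Even (S i i))
    (m' : ℤ) (hdet : ¬ (p : ℤ) ∣ S.det) (hm : ¬ (p : ℤ) ∣ m')
    (s : ℝ) (hs : (e : ℝ) + 1 < s) :
    Summable (fun ν : ℕ =>
      ‖(localCount p e S m' ν : ℝ) * (((p ^ ν : ℕ) : ℝ) ^ (-s))‖) ∧
    (∑' ν : ℕ, (localCount p e S m' ν : ℝ) * (((p ^ ν : ℕ) : ℝ) ^ (-s))) =
      (1 - (legendreSym p ((-1) ^ ((e + 1) / 2) * 2 * m' * S.det) : ℝ) *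
          (p : ℝ) ^ (((e : ℝ) - 1) / 2 - s)) /
        ((1 - (p : ℝ) ^ ((e : ℝ) - s)) *
          (1 - (legendreSym p ((-1) ^ ((e + 1) / 2) * 2 * m' * S.det) : ℝ) *
            (p : ℝ) ^ (((e : ℝ) + 1) / 2 - s))) := by
  have hpp : p.Prime := Fact.out
  obtain ⟨j, rfl⟩ := hodd
  set M : Matrix (Fin (2 * j + 1) ⊕ Unit) (Fin (2 * j + 1) ⊕ Unit) ℤ :=
    fromBlocks S 0 0 (of fun _ _ : Unit => 2 * m') with hMdef
  have hcard : Fintype.card (Fin (2 * j + 1) ⊕ Unit) = 2 * j + 2 := by simp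
  have hMsym : M.IsSymm := hsym.fromBlocks (by simp) (by ext; rfl)
  have hMdet : M.det = 2 * m' * S.det := by
    rw [hMdef, det_fromBlocks_zero₁₂, det_unique (of _)]
    simp [mul_comm]
  have hpZ : Prime (p : ℤ) := Nat.prime_iff_prime_int.1 hpp
  have hp2' : ¬ (p : ℤ) ∣ 2 := fun h =>
    hp2 ((Nat.prime_dvd_prime_iff_eq hpp Nat.prime_two).1 (by exact_mod_cast h))
  have hMdet' : ¬ (p : ℤ) ∣ M.det := by
    rw [hMdet]
    exact hpZ.not_dvd_mul (hpZ.not_dvd_mul hp2' hm) hdet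
  have hk : (2 * j + 1 + 1) / 2 = j + 1 := by omega
  have hdisc : (-1) ^ ((2 * j + 1 + 1) / 2) * 2 * m' * S.det = (-1) ^ (j + 1) * M.det := by
    rw [hk, hMdet]; ring
  rw [hdisc]
  have hp0 : (0 : ℝ) < p := by exact_mod_cast hpp.pos
  have hpow : ∀ (n : ℕ) (x : ℝ), x = n - s → (p : ℝ) ^ x = (p : ℝ) ^ n * (p : ℝ) ^ (-s) := by
    intro n x hx
    rw [hx, sub_eq_add_neg, Real.rpow_add hp0, Real.rpow_natCast]
  have hterm : ∀ ν : ℕ, ((p ^ ν : ℕ) : ℝ) ^ (-s) = ((p : ℝ) ^ (-s)) ^ ν := by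
    intro ν
    rw [Nat.cast_pow, ← Real.rpow_natCast, ← Real.rpow_natCast, ← Real.rpow_mul hp0.le,
      ← Real.rpow_mul hp0.le, mul_comm]
  have hε : ((legendreSym p ((-1) ^ (j + 1) * M.det) : ℤ) : ℝ) ^ 2 = 1 := by
    have : (((-1) ^ (j + 1) * M.det : ℤ) : ZMod p) ≠ 0 := by
      rw [Ne, ZMod.intCast_zmod_eq_zero_iff_dvd]
      exact hpZ.not_dvd_mul (fun h => hpZ.not_isUnit
        (isUnit_of_dvd_unit h ((isUnit_one.neg).pow _))) hMdet'
    exact_mod_cast legendreSym.sq_one p this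
  have hqT : (p : ℝ) ^ (2 * j + 2) * (p : ℝ) ^ (-s) < 1 := by
    rw [← hpow _ _ rfl]
    refine Real.rpow_lt_one_of_one_lt_of_neg (by exact_mod_cast hpp.one_lt) ?_
    push_cast at hs ⊢
    linarith
  have key := tsum_of_two_step_recurrence (q := p) (T := (p : ℝ) ^ (-s)) (j := j)
    (N := fun a => (M.zeroCount p a : ℝ)) (P := fun a => (M.primitiveZeroCount p a : ℝ))
    (by exact_mod_cast hpp.one_lt) (by positivity) hqT hε (fun a => by positivity)
    (fun a => by rw [← hcard]; exact_mod_cast M.zeroCount_le a)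
    (by exact_mod_cast M.zeroCount_zero) (by exact_mod_cast M.zeroCount_one)
    (fun a => by rw [← hcard]; exact_mod_cast M.zeroCount_add_two a)
    (fun a => by
      rw [← hcard]; exact_mod_cast primitiveZeroCount_succ_mul hp2 hMsym hMdet' (Nat.succ_ne_zero a))
    (Matrix.zeroCount_one_mul hp2 (k := j + 1) (by rw [hcard]; ring) hMsym hMdet')
  simp only [localCount_eq_zeroCount, ← hMdef, hterm]
  rw [hpow j ((((2 * j + 1 : ℕ) : ℝ) - 1) / 2 - s) (by push_cast; ring),
    hpow (2 * j + 1) (((2 * j + 1 : ℕ) : ℝ) - s) rfl,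
    hpow (j + 1) ((((2 * j + 1 : ℕ) : ℝ) + 1) / 2 - s) (by push_cast; ring)]
  exact ⟨by simpa only [Real.norm_eq_abs] using key.1.abs, key.2⟩
end

section
/- Let s, y, N be real numbers with s > 1 and y > 0. If N ≥ 0, then ∫_{−∞}^{∞} (x+iy)^{−s} · exp(2πi N (x+iy)) dx = 0. If N < 0, then ∫_{−∞}^{∞} (x+iy)^{−s} · exp(2πi N (x+iy)) dx = (2π)^s · |N|^{s−1} · exp(−πis/2) / Γ(s). -/
open MeasureTheory Complex Real

open scoped FourierTransform Topology

lemma norm_cpow_mul_exp_neg_mul {t : ℝ} (ht : 0 < t) (a z : ℂ) :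
    ‖(t : ℂ) ^ a * cexp (-(z * t))‖ = t ^ a.re * Real.exp (-z.re * t) := by
  rw [norm_mul, norm_cpow_eq_rpow_re_of_pos ht, Complex.norm_exp]
  simp

lemma aestronglyMeasurable_cpow_mul_exp_neg_mul (a z : ℂ) :
    AEStronglyMeasurable (fun t : ℝ ↦ (t : ℂ) ^ a * cexp (-(z * t)))
      (volume.restrict (Set.Ioi 0)) := by
  refine ContinuousOn.aestronglyMeasurable (fun t ht ↦ ContinuousAt.continuousWithinAt ?_)
    measurableSet_Ioi
  have h := continuousAt_ofReal_cpow_const t a (Or.inr (ne_of_gt ht))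
  exact h.mul (by fun_prop)

lemma integrableOn_rpow_mul_exp_neg_mul {c b : ℝ} (hc : -1 < c) (hb : 0 < b) :
    IntegrableOn (fun t : ℝ ↦ t ^ c * Real.exp (-b * t)) (Set.Ioi 0) := by
  simpa using integrableOn_rpow_mul_exp_neg_mul_rpow hc one_pos hb

lemma integrableOn_cpow_mul_exp_neg_mul {a z : ℂ} (ha : -1 < a.re) (hz : 0 < z.re) :
    IntegrableOn (fun t : ℝ ↦ (t : ℂ) ^ a * cexp (-(z * t))) (Set.Ioi 0) := by
  refine (integrableOn_rpow_mul_exp_neg_mul ha hz).mono'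
    (aestronglyMeasurable_cpow_mul_exp_neg_mul a z) ?_
  filter_upwards [ae_restrict_mem measurableSet_Ioi] with t ht
  exact (norm_cpow_mul_exp_neg_mul ht a z).le

lemma differentiableAt_integral_cpow_mul_exp_neg_mul {a z : ℂ} (ha : -1 < a.re) (hz : 0 < z.re) :
    DifferentiableAt ℂ (fun w : ℂ ↦ ∫ t : ℝ in Set.Ioi 0, (t : ℂ) ^ a * cexp (-(w * t))) z := by
  have hs : {w : ℂ | z.re / 2 < w.re} ∈ 𝓝 z :=
    (isOpen_lt continuous_const continuous_re).mem_nhds (by simpa using hz)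
  refine (hasDerivAt_integral_of_dominated_loc_of_deriv_le
    (F' := fun w t ↦ -((t : ℂ) ^ (a + 1) * cexp (-(w * t))))
    (bound := fun t ↦ t ^ (a.re + 1) * Real.exp (-(z.re / 2) * t)) hs
    (.of_forall fun w ↦ aestronglyMeasurable_cpow_mul_exp_neg_mul a w)
    (integrableOn_cpow_mul_exp_neg_mul ha hz)
    (aestronglyMeasurable_cpow_mul_exp_neg_mul (a + 1) z).neg ?_
    (integrableOn_rpow_mul_exp_neg_mul (by linarith) (by linarith)) ?_).2.differentiableAt
  · filter_upwards [ae_restrict_mem measurableSet_Ioi] with t (ht : 0 < t) w hw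
    rw [norm_neg, norm_cpow_mul_exp_neg_mul ht]
    simp only [add_re, one_re]
    have : z.re / 2 < w.re := hw
    gcongr
  · filter_upwards [ae_restrict_mem measurableSet_Ioi] with t (ht : 0 < t) w hw
    have h : HasDerivAt (fun w : ℂ ↦ -(w * t)) (-(1 * (t : ℂ))) w :=
      ((hasDerivAt_id w).mul_const (t : ℂ)).neg
    refine (h.cexp.const_mul ((t : ℂ) ^ a)).congr_deriv ?_
    rw [cpow_add _ _ (by exact_mod_cast ht.ne'), cpow_one]
    ring

/-- The Laplace transform of a power function on the right half-plane. -/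
lemma integral_cpow_mul_exp_neg_mul_Ioi_of_re_pos {a z : ℂ} (ha : 0 < a.re) (hz : 0 < z.re) :
    ∫ t : ℝ in Set.Ioi 0, (t : ℂ) ^ (a - 1) * cexp (-(z * t)) =
      z ^ (-a) * Complex.Gamma a := by
  let U : Set ℂ := {w | 0 < w.re}
  have hU : IsOpen U := isOpen_lt continuous_const continuous_re
  have hL : AnalyticOnNhd ℂ
      (fun w : ℂ ↦ ∫ t : ℝ in Set.Ioi 0, (t : ℂ) ^ (a - 1) * cexp (-(w * t))) U :=
    DifferentiableOn.analyticOnNhd (fun w hw ↦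
      (differentiableAt_integral_cpow_mul_exp_neg_mul (by simpa using ha)
        hw).differentiableWithinAt) hU
  have hR : AnalyticOnNhd ℂ (fun w : ℂ ↦ w ^ (-a) * Complex.Gamma a) U :=
    DifferentiableOn.analyticOnNhd (fun w hw ↦
      ((differentiableAt_id.cpow_const (Or.inl hw)).mul_const _).differentiableWithinAt) hU
  refine hL.eqOn_of_preconnected_of_frequently_eq hR (convex_halfSpace_re_gt 0).isPreconnected
    (z₀ := 1) (by simp [U]) ?_ hz
  have htend : Filter.Tendsto (fun r : ℝ ↦ (r : ℂ)) (𝓝[>] 1) (𝓝[≠] 1) := by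
    refine tendsto_nhdsWithin_iff.mpr ⟨?_, ?_⟩
    · exact (continuous_ofReal.tendsto' 1 1 (by simp)).mono_left nhdsWithin_le_nhds
    · filter_upwards [self_mem_nhdsWithin] with r (hr : 1 < r)
      exact ofReal_ne_one.mpr hr.ne'
  refine htend.frequently (Filter.Eventually.frequently ?_)
  filter_upwards [self_mem_nhdsWithin] with r (hr : 1 < r)
  have hr0 : 0 < r := by linarith
  rw [Complex.integral_cpow_mul_exp_neg_mul_Ioi ha hr0, one_div, cpow_neg, inv_cpow]
  rw [arg_ofReal_of_nonneg hr0.le]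
  exact pi_pos.ne

/-- On the right half-plane the principal power is multiplicative with respect to `I`. -/
lemma I_mul_cpow_of_re_pos {w : ℂ} (hw : 0 < w.re) (c : ℂ) :
    (Complex.I * w) ^ c = cexp (π * Complex.I / 2 * c) * w ^ c := by
  have hw0 : w ≠ 0 := by rintro rfl; simp at hw
  have harg := abs_lt.mp (abs_arg_lt_pi_div_two_iff.mpr (Or.inl hw))
  have hlog : Complex.log (Complex.I * w) = Complex.log Complex.I + Complex.log w := by
    refine (log_mul_eq_add_log_iff I_ne_zero hw0).mpr ?_
    rw [arg_I]
    constructor <;> linarith [harg.1, harg.2]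
  rw [cpow_def_of_ne_zero (mul_ne_zero I_ne_zero hw0), cpow_def_of_ne_zero hw0, hlog, log_I,
    add_mul, Complex.exp_add]
  ring_nf

lemma integrable_ofReal_add_mul_I_cpow {s y : ℝ} (hs : 1 < s) (hy : 0 < y) :
    Integrable fun x : ℝ ↦ ((x : ℂ) + y * Complex.I) ^ (-(s : ℂ)) := by
  have hne (x : ℝ) : (x : ℂ) + y * Complex.I ∈ slitPlane := by
    refine Or.inr ?_
    simpa using hy.ne'
  have hcont : Continuous fun x : ℝ ↦ ((x : ℂ) + y * Complex.I) ^ (-(s : ℂ)) :=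
    Continuous.cpow (by fun_prop) continuous_const hne
  have h := (integrable_rpow_neg_one_add_norm_sq (E := ℝ) (μ := volume) (r := s)
    (by simpa using hs)).comp_div hy.ne'
  refine (h.const_mul (y ^ (-s))).mono' hcont.aestronglyMeasurable (.of_forall fun x ↦ ?_)
  have hnorm : ‖(x : ℂ) + y * Complex.I‖ = y * √(1 + ‖x / y‖ ^ 2) := by
    rw [norm_add_mul_I, Real.norm_eq_abs, sq_abs, ← Real.sqrt_sq hy.le,
      ← Real.sqrt_mul (sq_nonneg y), Real.sqrt_sq hy.le]
    congr 1
    field_simp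
    ring
  rw [← ofReal_neg, norm_cpow_real, hnorm, Real.mul_rpow hy.le (Real.sqrt_nonneg _),
    Real.sqrt_eq_rpow, ← Real.rpow_mul (by positivity)]
  apply le_of_eq
  congr 2
  ring

/-- The function `t ↦ t₊ ^ (s - 1) * exp (-2 π y t)`, whose inverse Fourier transform is, up to a
constant, `x ↦ (x + i y) ^ (-s)`. -/
noncomputable def gammaKernel (s y t : ℝ) : ℂ :=
  ((max t 0 ^ (s - 1) * Real.exp (-(2 * π * y) * t) : ℝ) : ℂ)

lemma continuous_gammaKernel {s : ℝ} (hs : 1 < s) (y : ℝ) : Continuous (gammaKernel s y) := by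
  refine continuous_ofReal.comp (Continuous.mul ?_ (by fun_prop))
  exact (continuous_id.max continuous_const).rpow_const fun _ ↦ Or.inr (by linarith)

lemma gammaKernel_of_nonpos {s t : ℝ} (hs : 1 < s) (y : ℝ) (ht : t ≤ 0) :
    gammaKernel s y t = 0 := by
  simp [gammaKernel, max_eq_right ht, Real.zero_rpow (sub_pos.mpr hs).ne']

lemma integrable_gammaKernel {s y : ℝ} (hs : 1 < s) (hy : 0 < y) :
    Integrable (gammaKernel s y) := by
  have h : IntegrableOn (gammaKernel s y) (Set.Ioi 0) := by
    have hreal : IntegrableOn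
        (fun t : ℝ ↦ ((t ^ (s - 1) * Real.exp (-(2 * π * y) * t) : ℝ) : ℂ)) (Set.Ioi 0) :=
      (integrableOn_rpow_mul_exp_neg_mul (by linarith) (by positivity)).ofReal
    refine hreal.congr_fun (fun t (ht : 0 < t) ↦ ?_) measurableSet_Ioi
    simp [gammaKernel, max_eq_left ht.le]
  refine h.integrable_of_forall_notMem_eq_zero fun t ht ↦ ?_
  exact gammaKernel_of_nonpos hs y (by simpa using ht)

lemma fourierInv_gammaKernel {s y : ℝ} (hs : 1 < s) (hy : 0 < y) (x : ℝ) :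
    𝓕⁻ (gammaKernel s y) x =
      Complex.Gamma s * ((2 * π) ^ (-s) : ℝ) * cexp (π * Complex.I / 2 * s) *
        ((x : ℂ) + y * Complex.I) ^ (-(s : ℂ)) := by
  set w : ℂ := y - x * Complex.I with hw
  have hwre : 0 < w.re := by simpa [hw] using hy
  have hIw : (x : ℂ) + y * Complex.I = Complex.I * w := by
    rw [hw]; linear_combination (x : ℂ) * I_sq
  have hzre : 0 < (((2 * π : ℝ) : ℂ) * w).re := by
    rw [re_ofReal_mul]; positivity
  have hscale : (((2 * π : ℝ) : ℂ) * w) ^ (-(s : ℂ)) =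
      ((2 * π) ^ (-s) : ℝ) * w ^ (-(s : ℂ)) := by
    have hw0 : w ≠ 0 := by rintro h; simp [h] at hwre
    have hpi : ((2 * π : ℝ) : ℂ) ≠ 0 := ofReal_ne_zero.mpr two_pi_pos.ne'
    rw [cpow_def_of_ne_zero (mul_ne_zero hpi hw0), cpow_def_of_ne_zero hw0,
      log_ofReal_mul two_pi_pos hw0, Real.rpow_def_of_pos two_pi_pos, ofReal_exp, add_mul,
      Complex.exp_add]
    push_cast
    rfl
  have hint : 𝓕⁻ (gammaKernel s y) x =
      ∫ t : ℝ in Set.Ioi 0, (t : ℂ) ^ ((s : ℂ) - 1) * cexp (-(((2 * π : ℝ) : ℂ) * w * t)) := by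
    rw [Real.fourierInv_eq', ← setIntegral_eq_integral_of_forall_compl_eq_zero (s := Set.Ioi 0)
      fun t ht ↦ by rw [gammaKernel_of_nonpos hs y (by simpa using ht), smul_zero]]
    refine setIntegral_congr_fun measurableSet_Ioi fun t (ht : 0 < t) ↦ ?_
    simp only [gammaKernel, max_eq_left ht.le, smul_eq_mul]
    push_cast [ofReal_cpow ht.le]
    rw [mul_left_comm, ← Complex.exp_add]
    congr 2
    rw [hw]
    simp
    ring
  rw [hint, integral_cpow_mul_exp_neg_mul_Ioi_of_re_pos (by simp; linarith) hzre, hscale, hIw,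
    I_mul_cpow_of_re_pos hwre]
  have hexp : cexp (π * Complex.I / 2 * s) * cexp (π * Complex.I / 2 * -s) = 1 := by
    rw [← Complex.exp_add]; simp
  linear_combination (-(Complex.Gamma s * ((2 * π) ^ (-s) : ℝ) * w ^ (-(s : ℂ)))) * hexp

lemma integral_ofReal_add_mul_I_cpow_mul_exp {s y : ℝ} (hs : 1 < s) (hy : 0 < y) (N : ℝ) :
    ∫ x : ℝ, ((x : ℂ) + (y : ℂ) * Complex.I) ^ (-(s : ℂ)) *
        cexp (2 * π * Complex.I * (N : ℂ) * ((x : ℂ) + (y : ℂ) * Complex.I)) =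
      (((2 * π) ^ s : ℝ) : ℂ) * ((max (-N) 0 ^ (s - 1) : ℝ) : ℂ) *
        cexp (-π * Complex.I * (s : ℂ) / 2) / Complex.Gamma (s : ℂ) := by
  have hΓ : Complex.Gamma s ≠ 0 := Complex.Gamma_ne_zero_of_re_pos (by simp; linarith)
  set C : ℂ := Complex.Gamma s * ((2 * π) ^ (-s) : ℝ) * cexp (π * Complex.I / 2 * s) with hC
  have hinv : 𝓕⁻ (gammaKernel s y) =
      fun x : ℝ ↦ C * ((x : ℂ) + y * Complex.I) ^ (-(s : ℂ)) :=
    funext fun x ↦ fourierInv_gammaKernel hs hy x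
  have hF : Integrable (𝓕 (gammaKernel s y)) := by
    have h := ((integrable_ofReal_add_mul_I_cpow hs hy).const_mul C).comp_neg
    convert h using 2 with x
    rw [← congr_fun hinv (-x), Real.fourierInv_eq_fourier_neg, neg_neg]
  have key := congr_fun ((continuous_gammaKernel hs y).fourier_fourierInv_eq
    (integrable_gammaKernel hs hy) hF) (-N)
  rw [hinv, Real.fourier_real_eq_integral_exp_smul] at key
  have hrw : ∫ x : ℝ, ((x : ℂ) + (y : ℂ) * Complex.I) ^ (-(s : ℂ)) *
        cexp (2 * π * Complex.I * (N : ℂ) * ((x : ℂ) + (y : ℂ) * Complex.I)) =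
      C⁻¹ * cexp (-(2 * π * N * y)) * gammaKernel s y (-N) := by
    have hC0 : C ≠ 0 := by
      refine mul_ne_zero (mul_ne_zero hΓ ?_) (Complex.exp_ne_zero _)
      exact_mod_cast (Real.rpow_pos_of_pos two_pi_pos _).ne'
    rw [← key, ← integral_const_mul]
    congr 1 with x
    have : cexp (2 * π * Complex.I * (N : ℂ) * ((x : ℂ) + (y : ℂ) * Complex.I)) =
        cexp (-(2 * π * N * y)) * cexp (((-2 * π * x * -N : ℝ) : ℂ) * Complex.I) := by
      rw [← Complex.exp_add]
      congr 1
      push_cast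
      linear_combination (2 * π * N * y : ℂ) * I_sq
    rw [this, smul_eq_mul]
    field_simp
  have hexp : cexp (-(2 * π * N * y)) * cexp (2 * π * N * y) = 1 := by
    rw [← Complex.exp_add]; simp
  have hkernel : gammaKernel s y (-N) =
      ((max (-N) 0 ^ (s - 1) : ℝ) : ℂ) * cexp (2 * π * N * y) := by
    rw [gammaKernel]
    push_cast
    ring_nf
  have hCinv : C⁻¹ = (((2 * π) ^ s : ℝ) : ℂ) * cexp (-π * Complex.I * (s : ℂ) / 2) /
      Complex.Gamma (s : ℂ) := by
    rw [hC, Real.rpow_neg two_pi_pos.le, mul_inv, mul_inv, ofReal_inv, inv_inv, ← Complex.exp_neg]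
    ring_nf
  rw [hrw, hkernel, hCinv]
  linear_combination (((2 * π) ^ s : ℝ) : ℂ) * cexp (-π * Complex.I * (s : ℂ) / 2) /
      Complex.Gamma (s : ℂ) * ((max (-N) 0 ^ (s - 1) : ℝ) : ℂ) * hexp

/-- For real `s > 1`, `y > 0` and real `N`:
if `N ≥ 0` then `∫ (x+iy)^{−s} e^{2πiN(x+iy)} dx = 0`, and if `N < 0` then the integral
equals `(2π)^s |N|^{s−1} e^{−πis/2} / Γ(s)` (principal branch of the complex power). -/
theorem line_integral_cpow_exponential (s y N : ℝ) (hs : 1 < s) (hy : 0 < y) :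
    (0 ≤ N →
      (∫ x : ℝ, ((x : ℂ) + (y : ℂ) * Complex.I) ^ (-(s : ℂ)) *
        Complex.exp (2 * Real.pi * Complex.I * (N : ℂ) * ((x : ℂ) + (y : ℂ) * Complex.I)))
        = 0) ∧
    (N < 0 →
      (∫ x : ℝ, ((x : ℂ) + (y : ℂ) * Complex.I) ^ (-(s : ℂ)) *
        Complex.exp (2 * Real.pi * Complex.I * (N : ℂ) * ((x : ℂ) + (y : ℂ) * Complex.I)))
        = (((2 * Real.pi) ^ s : ℝ) : ℂ) * ((|N| ^ (s - 1) : ℝ) : ℂ) *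
            Complex.exp (-Real.pi * Complex.I * (s : ℂ) / 2) / Complex.Gamma (s : ℂ)) := by
  rw [integral_ofReal_add_mul_I_cpow_mul_exp hs hy N]
  refine ⟨fun hN ↦ ?_, fun hN ↦ ?_⟩
  · rw [max_eq_right (by linarith), Real.zero_rpow (by linarith)]
    simp
  · rw [max_eq_left (by linarith), abs_of_neg hN]
end

section
/- Let τ ∈ ℂ with Im(τ) > 0, let m > 0 and r, v be real numbers. Then ∫_{−∞}^{∞} exp(2πi·(−r(u+iv) − m(u+iv)²/τ)) du = exp(2πi·r²τ/(4m)) · √(τ/(2im)), where √ denotes the principal branch of the complex square root (note that τ/(2im) = −iτ/(2m) has positive real part). -/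
open MeasureTheory Complex Real

/-- Gaussian integral: for `τ ∈ ℍ`, `m > 0` and real `r, v`,
`∫ e^{2πi(−r(u+iv) − m(u+iv)²/τ)} du = e^{2πi r²τ/(4m)} · √(τ/(2im))`,
with the principal branch of the square root (`τ/(2im)` has positive real part). -/
theorem gaussian_integral_shifted (τ : ℂ) (hτ : 0 < τ.im) (m r v : ℝ) (hm : 0 < m) :
    (∫ u : ℝ, Complex.exp (2 * Real.pi * Complex.I *
        (-(r : ℂ) * ((u : ℂ) + (v : ℂ) * Complex.I) -
          (m : ℂ) * ((u : ℂ) + (v : ℂ) * Complex.I) ^ 2 / τ))) =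
      Complex.exp (2 * Real.pi * Complex.I * (r : ℂ) ^ 2 * τ / (4 * (m : ℂ))) *
        (τ / (2 * Complex.I * (m : ℂ))) ^ ((1 : ℂ) / 2) := by
  have hτ0 : τ ≠ 0 := by
    rintro rfl
    simp at hτ
  have hm0 : (m : ℂ) ≠ 0 := by exact_mod_cast hm.ne'
  have hπ0 : (Real.pi : ℂ) ≠ 0 := by exact_mod_cast Real.pi_ne_zero
  have hb : (-(2 * Real.pi * Complex.I * (m : ℂ) / τ)).re < 0 := by
    have hre : (-(2 * Real.pi * Complex.I * (m : ℂ) / τ)).re =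
        -(2 * Real.pi * m * (τ.im / Complex.normSq τ)) := by
      simp [Complex.div_re]
      ring
    rw [hre, neg_lt_zero]
    have := Complex.normSq_pos.mpr hτ0
    positivity
  have key := integral_cexp_quadratic hb
    (2 * Real.pi * Complex.I * (-(r : ℂ) - 2 * m * v * Complex.I / τ))
    (2 * Real.pi * Complex.I * (-(r : ℂ) * (v * Complex.I) - m * (v * Complex.I) ^ 2 / τ))
  have hbase : (Real.pi : ℂ) / - -(2 * Real.pi * Complex.I * (m : ℂ) / τ) =
      τ / (2 * Complex.I * (m : ℂ)) := by
    field_simp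
  rw [hbase, mul_comm (_ ^ _) (cexp _)] at key
  convert! key using 2
  · ext u
    congr 1
    ring
  · congr 1
    field_simp
    ring
end
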